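/- arXiv:2305.19473 — 4 statements merged into one kernel-verified Lean document; each statement's English description precedes it below -/
import Mathlib

section
/- With the setup of m i.i.d. Gaussian measurements Y_k = X + N_k, N_k ~ N(0,σ²I), the averaged conditional Hessians are monotone: 𝔼_{y₁}[∇²_{y₁} log p(y₁)] ≽ 𝔼_{y_{1:2}}[∇²_{y₂} log p(y₂|y₁)] ≽ ··· ≽ 𝔼_{y_{1:m}}[∇²_{y_m} log p(y_m|y_{1:m−1})] in the Loewner order. -/
open MeasureTheory Real

noncomputable section

def sqDist {d : ℕ} (x y : Fin d → ℝ) : ℝ := ∑ i, (x i - y i) ^ 2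

def gKer (d : ℕ) (σ : ℝ) (x y : Fin d → ℝ) : ℝ :=
  (2 * π * σ ^ 2) ^ (-(d : ℝ) / 2) * Real.exp (-sqDist x y / (2 * σ ^ 2))

def hess' {d : ℕ} (g : (Fin d → ℝ) → ℝ) (y : Fin d → ℝ) : Matrix (Fin d) (Fin d) ℝ :=
  Matrix.of fun i j => fderiv ℝ (fun z => fderiv ℝ g z (Pi.single j 1)) y (Pi.single i 1)

def jointD {d : ℕ} (p : (Fin d → ℝ) → ℝ) (σ : ℝ) (n : ℕ) (y : Fin n → Fin d → ℝ) : ℝ :=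
  ∫ x : Fin d → ℝ, p x * ∏ k, gKer d σ x (y k)

/-- Hessian in `y_{n+1}` of the log conditional density `p(y_{n+1} | y_{1:n})`. -/
def condHess {d : ℕ} (p : (Fin d → ℝ) → ℝ) (σ : ℝ) (n : ℕ)
    (y : Fin (n + 1) → Fin d → ℝ) : Matrix (Fin d) (Fin d) ℝ :=
  hess' (fun z =>
      Real.log (jointD p σ (n + 1) (Function.update y (Fin.last n) z)
        / jointD p σ n (fun k => y k.castSucc)))
    (y (Fin.last n))

/-- Averaged Hessian `𝔼_{y_{1:n+1}}[∇²_{y_{n+1}} log p(y_{n+1}|y_{1:n})]` under the joint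
density of the first `n+1` measurements. -/
def avgHess {d : ℕ} (p : (Fin d → ℝ) → ℝ) (σ : ℝ) (n : ℕ) : Matrix (Fin d) (Fin d) ℝ :=
  Matrix.of fun i j =>
    ∫ y : Fin (n + 1) → Fin d → ℝ, jointD p σ (n + 1) y * condHess p σ n y i j

lemma Continuous.gKer {X : Type*} [TopologicalSpace X] {d : ℕ} (σ : ℝ)
    {u v : X → Fin d → ℝ} (hu : Continuous u) (hv : Continuous v) :
    Continuous fun a => gKer d σ (u a) (v a) := by
  unfold _root_.gKer sqDist
  fun_prop

lemma gKer_pos {d : ℕ} {σ : ℝ} (hσ : 0 < σ) (x y : Fin d → ℝ) : 0 < gKer d σ x y := by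
  unfold gKer
  positivity

lemma gKer_le {d : ℕ} (σ : ℝ) (x z : Fin d → ℝ) :
    gKer d σ x z ≤ (2 * π * σ ^ 2) ^ (-(d : ℝ) / 2) := by
  unfold gKer
  refine mul_le_of_le_one_right (by positivity) (Real.exp_le_one_iff.2 ?_)
  have : 0 ≤ sqDist x z := Finset.sum_nonneg fun i _ => sq_nonneg _
  rw [neg_div]
  exact neg_nonpos.2 (by positivity)

lemma gKer_eq_prod {d : ℕ} {σ : ℝ} (hσ : 0 < σ) (x y : Fin d → ℝ) :
    gKer d σ x y = ∏ i, ProbabilityTheory.gaussianPDFReal (x i) (σ.toNNReal ^ 2) (y i) := by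
  have hc : 0 ≤ 2 * π * σ ^ 2 := by positivity
  simp only [ProbabilityTheory.gaussianPDFReal, gKer, sqDist, Finset.prod_mul_distrib,
    Finset.prod_const, ← Real.exp_sum, Finset.card_univ, Fintype.card_fin, NNReal.coe_pow, Real.coe_toNNReal σ hσ.le]
  congr 1
  · rw [Real.sqrt_eq_rpow, ← Real.rpow_neg hc, ← Real.rpow_natCast _ d, ← Real.rpow_mul hc]
    congr 1
    ring
  · congr 1
    rw [neg_div, Finset.sum_div, ← Finset.sum_neg_distrib]
    refine Finset.sum_congr rfl fun i _ => ?_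
    ring

lemma integrable_gKer {d : ℕ} {σ : ℝ} (hσ : 0 < σ) (x : Fin d → ℝ) :
    Integrable (gKer d σ x) := by
  rw [funext (gKer_eq_prod hσ x)]
  exact Integrable.fintype_prod fun i => ProbabilityTheory.integrable_gaussianPDFReal _ _

lemma integral_gKer {d : ℕ} {σ : ℝ} (hσ : 0 < σ) (x : Fin d → ℝ) :
    ∫ y, gKer d σ x y = 1 := by
  rw [funext (gKer_eq_prod hσ x), integral_fintype_prod_volume_eq_prod]
  refine Finset.prod_eq_one fun i _ => ?_
  refine ProbabilityTheory.integral_gaussianPDFReal_eq_one _ fun h => ?_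
  exact (pow_pos (Real.toNNReal_pos.2 hσ) 2).ne' h

/-- Integrating an integrable function against a Markov density. -/
lemma integrable_mul_density {α β : Type*} [MeasureSpace α] [MeasureSpace β]
    [SFinite (volume : Measure α)] [SFinite (volume : Measure β)]
    {g : α → ℝ} (hg : Integrable g) {K : α → β → ℝ}
    (hK : AEStronglyMeasurable (fun q : α × β => K q.1 q.2) (volume.prod volume))
    (hK0 : ∀ x y, 0 ≤ K x y)
    (hKi : ∀ x, Integrable (K x)) (hK1 : ∀ x, ∫ y, K x y = 1) :
    Integrable (fun q : α × β => g q.1 * K q.1 q.2) (volume.prod volume) := by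
  have hm : AEStronglyMeasurable (fun q : α × β => g q.1 * K q.1 q.2) (volume.prod volume) :=
    hg.aestronglyMeasurable.comp_fst.mul hK
  rw [integrable_prod_iff hm]
  refine ⟨ae_of_all _ fun x => (hKi x).const_mul (g x), ?_⟩
  refine hg.norm.congr (ae_of_all _ fun x => ?_)
  simp only [norm_mul, integral_const_mul, Real.norm_of_nonneg (hK0 _ _), hK1, mul_one]

lemma integrable_integral_mul_density {α β : Type*} [MeasureSpace α] [MeasureSpace β]
    [SFinite (volume : Measure α)] [SFinite (volume : Measure β)]
    {g : α → ℝ} (hg : Integrable g) {K : α → β → ℝ}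
    (hK : AEStronglyMeasurable (fun q : α × β => K q.1 q.2) (volume.prod volume))
    (hK0 : ∀ x y, 0 ≤ K x y)
    (hKi : ∀ x, Integrable (K x)) (hK1 : ∀ x, ∫ y, K x y = 1) :
    Integrable (fun y => ∫ x, g x * K x y) ∧ ∫ y, ∫ x, g x * K x y = ∫ x, g x := by
  have h := integrable_mul_density hg hK hK0 hKi hK1
  refine ⟨h.integral_prod_right, ?_⟩
  rw [← integral_integral_swap (f := fun x y => g x * K x y) h]
  simp only [integral_const_mul, hK1, mul_one]

section MeasurementDensity

variable {d : ℕ} {σ : ℝ} {g : (Fin d → ℝ) → ℝ}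

lemma integrable_mul_prod_gKer (hσ : 0 < σ) (hg : Integrable g) (n : ℕ)
    (y : Fin n → Fin d → ℝ) : Integrable fun x => g x * ∏ k, gKer d σ x (y k) := by
  have hc : Continuous fun x : Fin d → ℝ => ∏ k, gKer d σ x (y k) :=
    continuous_finsetProd _ fun k _ => continuous_id.gKer σ continuous_const
  refine hg.mul_bdd (c := ∏ _k : Fin n, (2 * π * σ ^ 2) ^ (-(d : ℝ) / 2))
    hc.aestronglyMeasurable (ae_of_all _ fun x => ?_)
  rw [Real.norm_of_nonneg (Finset.prod_nonneg fun k _ => (gKer_pos hσ _ _).le)]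
  refine Finset.prod_le_prod (fun k _ => (gKer_pos hσ _ _).le) fun k _ => gKer_le σ x (y k)

lemma integrable_jointD (hσ : 0 < σ) (hg : Integrable g) (n : ℕ) :
    Integrable (jointD g σ n) ∧ ∫ y, jointD g σ n y = ∫ x, g x := by
  have hc : Continuous fun q : (Fin d → ℝ) × (Fin n → Fin d → ℝ) =>
      ∏ k, gKer d σ q.1 (q.2 k) :=
    continuous_finsetProd _ fun k _ => continuous_fst.gKer σ
      (v := fun q : (Fin d → ℝ) × (Fin n → Fin d → ℝ) => q.2 k) (by fun_prop)
  have hK0 (x : Fin d → ℝ) (y : Fin n → Fin d → ℝ) : 0 ≤ ∏ k, gKer d σ x (y k) :=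
    Finset.prod_nonneg fun k _ => (gKer_pos hσ _ _).le
  have hKi (x : Fin d → ℝ) :
      Integrable fun y : Fin n → Fin d → ℝ => ∏ k, gKer d σ x (y k) :=
    Integrable.fintype_prod fun _ => integrable_gKer hσ x
  have hK1 (x : Fin d → ℝ) : ∫ y : Fin n → Fin d → ℝ, ∏ k, gKer d σ x (y k) = 1 := by
    rw [integral_fintype_prod_volume_eq_prod (f := fun _ => gKer d σ x)]
    simp [integral_gKer hσ]
  exact integrable_integral_mul_density hg hc.aestronglyMeasurable hK0 hKi hK1

lemma jointD_succ (n : ℕ) (y : Fin (n + 1) → Fin d → ℝ) :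
    jointD g σ (n + 1) y =
      ∫ x, (g x * ∏ k : Fin n, gKer d σ x (y k.castSucc)) * gKer d σ x (y (Fin.last n)) := by
  simp only [jointD, Fin.prod_univ_castSucc, mul_assoc]

lemma jointD_insertNth (n : ℕ) (z : Fin d → ℝ) (y : Fin n → Fin d → ℝ) :
    jointD g σ (n + 1) ((Fin.last n).insertNth (α := fun _ => Fin d → ℝ) z y) =
      ∫ x, (g x * ∏ k, gKer d σ x (y k)) * gKer d σ x z := by
  rw [jointD_succ]
  simp only [Fin.insertNth_last', Fin.snoc_castSucc, Fin.snoc_last]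

lemma jointD_marginal (hσ : 0 < σ) (hg : Integrable g) (n : ℕ) (y : Fin n → Fin d → ℝ) :
    Integrable (fun z => jointD g σ (n + 1)
      ((Fin.last n).insertNth (α := fun _ => Fin d → ℝ) z y)) ∧
    ∫ z, jointD g σ (n + 1) ((Fin.last n).insertNth (α := fun _ => Fin d → ℝ) z y) =
      jointD g σ n y := by
  simp only [jointD_insertNth]
  exact integrable_integral_mul_density (integrable_mul_prod_gKer hσ hg n y)
    (continuous_fst.gKer σ continuous_snd).aestronglyMeasurable (fun _ _ => (gKer_pos hσ _ _).le)
    (integrable_gKer hσ) (integral_gKer hσ)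

end MeasurementDensity

/-- Convolution of a weight with the Gaussian kernel. -/
def gaussSmooth {d : ℕ} (w : (Fin d → ℝ) → ℝ) (σ : ℝ) (z : Fin d → ℝ) : ℝ :=
  ∫ x, w x * gKer d σ x z

section Smoothing

variable {d : ℕ} {σ : ℝ} {w : (Fin d → ℝ) → ℝ}

/-- The derivative in `z` of `(σ ^ 2) * log (gKer d σ x z)`. -/
def displacement {d : ℕ} (x z : Fin d → ℝ) : (Fin d → ℝ) →L[ℝ] ℝ :=
  ∑ i, (x i - z i) • ContinuousLinearMap.proj (R := ℝ) (φ := fun _ : Fin d => ℝ) i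

lemma displacement_single (x z : Fin d → ℝ) (j : Fin d) :
    displacement x z (Pi.single j 1) = x j - z j := by
  simp [displacement, Pi.single_apply]

lemma norm_displacement_le (x z : Fin d → ℝ) : ‖displacement x z‖ ≤ ∑ i, |x i - z i| := by
  refine (norm_sum_le _ _).trans (Finset.sum_le_sum fun i _ => ?_)
  rw [norm_smul, Real.norm_eq_abs]
  refine mul_le_of_le_one_right (abs_nonneg _) ?_
  refine ContinuousLinearMap.opNorm_le_bound _ zero_le_one fun y => ?_
  simpa using norm_le_pi_norm y i

lemma continuous_displacement (z : Fin d → ℝ) :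
    Continuous fun x : Fin d → ℝ => displacement x z := by
  unfold displacement
  fun_prop

lemma hasFDerivAt_gKer (σ : ℝ) (x z : Fin d → ℝ) :
    HasFDerivAt (gKer d σ x) (gKer d σ x z • (σ ^ 2)⁻¹ • displacement x z) z := by
  have h1 : HasFDerivAt (fun y : Fin d → ℝ => sqDist x y)
      (-(2 : ℝ) • displacement x z) z := by
    have h (i : Fin d) : HasFDerivAt (fun y : Fin d → ℝ => (x i - y i) ^ 2)
        (-(2 : ℝ) • (x i - z i) •
          ContinuousLinearMap.proj (R := ℝ) (φ := fun _ : Fin d => ℝ) i) z := by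
      have := ((hasFDerivAt_apply (𝕜 := ℝ) i z).const_sub (x i)).pow 2
      refine this.congr_fderiv ?_
      ext v
      simp
      ring
    have := HasFDerivAt.fun_sum (u := Finset.univ) fun i _ => h i
    simpa only [sqDist, displacement, Finset.smul_sum] using this
  have h2 := ((h1.neg.mul_const (2 * σ ^ 2)⁻¹).exp).const_mul
    ((2 * π * σ ^ 2) ^ (-(d : ℝ) / 2))
  refine (h2.congr_fderiv ?_).congr_of_eventuallyEq (Filter.Eventually.of_forall fun y => ?_)
  · ext v
    simp [gKer, div_eq_mul_inv]
    ring
  · simp [gKer, div_eq_mul_inv]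

lemma integrable_mul_gKer (hσ : 0 < σ) (hw : Integrable w) (z : Fin d → ℝ) :
    Integrable fun x => w x * gKer d σ x z := by
  refine hw.mul_bdd (c := (2 * π * σ ^ 2) ^ (-(d : ℝ) / 2))
    (continuous_id.gKer σ continuous_const).aestronglyMeasurable (ae_of_all _ fun x => ?_)
  rw [Real.norm_of_nonneg (gKer_pos hσ _ _).le]
  exact gKer_le σ x z

lemma hasFDerivAt_gaussSmooth (hσ : 0 < σ) (hw : Integrable w)
    (hw1 : ∀ i, Integrable fun x => w x * x i) (z : Fin d → ℝ) :
    Integrable (fun x => w x • gKer d σ x z • (σ ^ 2)⁻¹ • displacement x z) ∧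
    HasFDerivAt (gaussSmooth w σ)
      (∫ x, w x • gKer d σ x z • (σ ^ 2)⁻¹ • displacement x z) z := by
  set C : ℝ := (2 * π * σ ^ 2) ^ (-(d : ℝ) / 2) with hC
  have hC0 : 0 ≤ C := by positivity
  have hmeas : AEStronglyMeasurable
      (fun x => w x • gKer d σ x z • (σ ^ 2)⁻¹ • displacement x z) := by
    refine hw.aestronglyMeasurable.smul (Continuous.aestronglyMeasurable ?_)
    have hc : Continuous fun x : Fin d → ℝ => (σ ^ 2)⁻¹ • displacement x z := by
      have := continuous_displacement z
      fun_prop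
    exact (continuous_id.gKer σ continuous_const).smul hc
  have hbi : Integrable
      fun x => C * (σ ^ 2)⁻¹ * ∑ i, (|w x * x i| + |w x| * (|z i| + 1)) :=
    (integrable_finsetSum _ fun i _ => (hw1 i).abs.add (hw.abs.mul_const _)).const_mul _
  have hbound : ∀ x, ∀ y ∈ Metric.ball z 1,
      ‖w x • gKer d σ x y • (σ ^ 2)⁻¹ • displacement x y‖ ≤
        C * (σ ^ 2)⁻¹ * ∑ i, (|w x * x i| + |w x| * (|z i| + 1)) := by
    intro x y hy
    rw [norm_smul, norm_smul, norm_smul, Real.norm_of_nonneg (gKer_pos hσ x y).le,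
      Real.norm_of_nonneg (by positivity : 0 ≤ (σ ^ 2)⁻¹), Real.norm_eq_abs]
    have hD : ‖displacement x y‖ ≤ ∑ i, (|x i| + (|z i| + 1)) := by
      refine (norm_displacement_le x y).trans (Finset.sum_le_sum fun i _ => ?_)
      have h1 : |y i - z i| ≤ 1 := by
        have h := (dist_le_pi_dist y z i).trans (Metric.mem_ball.1 hy).le
        rwa [Real.dist_eq] at h
      have h2 := abs_sub_abs_le_abs_sub (y i) (z i)
      have h3 := abs_sub (x i) (y i)
      linarith
    calc |w x| * (gKer d σ x y * ((σ ^ 2)⁻¹ * ‖displacement x y‖))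
        ≤ |w x| * (C * ((σ ^ 2)⁻¹ * ∑ i, (|x i| + (|z i| + 1)))) := by
          gcongr
          exact gKer_le σ x y
      _ = C * (σ ^ 2)⁻¹ * ∑ i, (|w x * x i| + |w x| * (|z i| + 1)) := by
          simp only [abs_mul, ← mul_add, ← Finset.mul_sum]
          ring
  refine ⟨hbi.mono' hmeas (ae_of_all _ fun x => hbound x z (Metric.mem_ball_self one_pos)), ?_⟩
  refine hasFDerivAt_integral_of_dominated_of_fderiv_le (𝕜 := ℝ)
    (F := fun y x => w x * gKer d σ x y)
    (F' := fun y x => w x • gKer d σ x y • (σ ^ 2)⁻¹ • displacement x y)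
    (Metric.ball_mem_nhds z one_pos)
    (Filter.Eventually.of_forall fun y => (integrable_mul_gKer hσ hw y).aestronglyMeasurable)
    (integrable_mul_gKer hσ hw z) hmeas (ae_of_all _ hbound) hbi
    (ae_of_all _ fun x y _ => (hasFDerivAt_gKer σ x y).const_mul (w x))

lemma differentiable_gaussSmooth (hσ : 0 < σ) (hw : Integrable w)
    (hw1 : ∀ i, Integrable fun x => w x * x i) : Differentiable ℝ (gaussSmooth w σ) :=
  fun z => (hasFDerivAt_gaussSmooth hσ hw hw1 z).2.differentiableAt

lemma fderiv_gaussSmooth (hσ : 0 < σ) (hw : Integrable w)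
    (hw1 : ∀ i, Integrable fun x => w x * x i) (z : Fin d → ℝ) (j : Fin d) :
    fderiv ℝ (gaussSmooth w σ) z (Pi.single j 1) =
      (σ ^ 2)⁻¹ * (gaussSmooth (fun x => w x * x j) σ z - z j * gaussSmooth w σ z) := by
  obtain ⟨hi, hd⟩ := hasFDerivAt_gaussSmooth hσ hw hw1 z
  rw [hd.fderiv, ContinuousLinearMap.integral_apply hi]
  simp only [gaussSmooth, smul_apply, displacement_single, smul_eq_mul]
  rw [← integral_const_mul, ← integral_sub (integrable_mul_gKer hσ (hw1 j) z)
    ((integrable_mul_gKer hσ hw z).const_mul _), ← integral_const_mul]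
  refine integral_congr_ae (ae_of_all _ fun x => ?_)
  simp only
  ring

/-- The Hessian of a log Gaussian mixture is an affine function of its posterior covariance. -/
lemma hess'_log_gaussSmooth (hσ : 0 < σ) (hw : Integrable w)
    (hw1 : ∀ i, Integrable fun x => w x * x i)
    (hw2 : ∀ i j, Integrable fun x => w x * x i * x j)
    (hpos : ∀ z, 0 < gaussSmooth w σ z) {c : ℝ} (hc : 0 < c) (z : Fin d → ℝ) (i j : Fin d) :
    hess' (fun z => Real.log (gaussSmooth w σ z / c)) z i j =
      (σ ^ 4)⁻¹ * (gaussSmooth (fun x => w x * x j * x i) σ z / gaussSmooth w σ z -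
        gaussSmooth (fun x => w x * x i) σ z * gaussSmooth (fun x => w x * x j) σ z /
          gaussSmooth w σ z ^ 2) - (σ ^ 2)⁻¹ * (if i = j then 1 else 0) := by
  have hd := differentiable_gaussSmooth hσ hw hw1
  have hdj := differentiable_gaussSmooth hσ (hw1 j) (hw2 j)
  have hlog : (fun z => Real.log (gaussSmooth w σ z / c)) =
      fun z => Real.log (gaussSmooth w σ z) - Real.log c :=
    funext fun z => Real.log_div (hpos z).ne' hc.ne'
  have hfirst : (fun y => fderiv ℝ (fun z => Real.log (gaussSmooth w σ z / c)) y
      (Pi.single j 1)) = fun y => (σ ^ 2)⁻¹ *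
        (gaussSmooth (fun x => w x * x j) σ y * (gaussSmooth w σ y)⁻¹ - y j) := by
    funext y
    rw [hlog, (((hd y).hasFDerivAt.log (hpos y).ne').sub_const _).fderiv,
      smul_apply, fderiv_gaussSmooth hσ hw hw1, smul_eq_mul]
    have := (hpos y).ne'
    field_simp
  have hinv : HasFDerivAt (fun y => (gaussSmooth w σ y)⁻¹)
      (-(gaussSmooth w σ z ^ 2)⁻¹ • fderiv ℝ (gaussSmooth w σ) z) z :=
    (hasDerivAt_inv (hpos z).ne').comp_hasFDerivAt z (hd z).hasFDerivAt
  have hsecond := (((hdj z).hasFDerivAt.mul hinv).sub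
    (hasFDerivAt_apply (𝕜 := ℝ) j z)).const_mul (σ ^ 2)⁻¹
  simp only [hess', Matrix.of_apply, hfirst]
  erw [hsecond.fderiv]
  simp only [smul_apply, sub_apply,
    add_apply, ContinuousLinearMap.proj_apply, smul_eq_mul,
    fderiv_gaussSmooth hσ hw hw1, fderiv_gaussSmooth hσ (hw1 j) (hw2 j), Pi.single_apply,
    eq_comm (a := j)]
  have := (hpos z).ne'
  field_simp
  ring

end Smoothing

section Moments

variable {d : ℕ} {σ : ℝ} {p : (Fin d → ℝ) → ℝ}

lemma condHess_apply (hσ : 0 < σ) (hpi : Integrable p)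
    (h1 : ∀ i, Integrable fun x => p x * x i)
    (h2 : ∀ i j, Integrable fun x => p x * (x i * x j))
    (hpos : ∀ (n : ℕ) (y : Fin n → Fin d → ℝ), 0 < jointD p σ n y)
    (n : ℕ) (y : Fin (n + 1) → Fin d → ℝ) (i j : Fin d) :
    condHess p σ n y i j =
      (σ ^ 4)⁻¹ * (jointD (fun x => p x * (x i * x j)) σ (n + 1) y / jointD p σ (n + 1) y -
        jointD (fun x => p x * x i) σ (n + 1) y * jointD (fun x => p x * x j) σ (n + 1) y /
          jointD p σ (n + 1) y ^ 2) - (σ ^ 2)⁻¹ * (if i = j then 1 else 0) := by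
  set w : (Fin d → ℝ) → ℝ := fun x => p x * ∏ k : Fin n, gKer d σ x (y k.castSucc) with hw
  have hw0 : Integrable w := integrable_mul_prod_gKer hσ hpi n _
  have hw1 (i : Fin d) : Integrable fun x => w x * x i :=
    (integrable_mul_prod_gKer hσ (h1 i) n fun k => y k.castSucc).congr
      (ae_of_all _ fun x => by simp only [hw]; ring)
  have hw2 (i j : Fin d) : Integrable fun x => w x * x i * x j :=
    (integrable_mul_prod_gKer hσ (h2 i j) n fun k => y k.castSucc).congr
      (ae_of_all _ fun x => by simp only [hw]; ring)
  have hupd (z : Fin d → ℝ) :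
      jointD p σ (n + 1) (Function.update y (Fin.last n) z) = gaussSmooth w σ z := by
    rw [jointD_succ]
    simp [gaussSmooth, hw, (Fin.castSucc_lt_last _).ne]
  have hwpos (z : Fin d → ℝ) : 0 < gaussSmooth w σ z := hupd z ▸ hpos _ _
  have e0 : jointD p σ (n + 1) y = gaussSmooth w σ (y (Fin.last n)) := by
    rw [jointD_succ]; rfl
  have e1 (i : Fin d) : jointD (fun x => p x * x i) σ (n + 1) y =
      gaussSmooth (fun x => w x * x i) σ (y (Fin.last n)) := by
    rw [jointD_succ]
    exact integral_congr_ae (ae_of_all _ fun x => by simp only [hw]; ring)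
  have e2 : jointD (fun x => p x * (x i * x j)) σ (n + 1) y =
      gaussSmooth (fun x => w x * x j * x i) σ (y (Fin.last n)) := by
    rw [jointD_succ]
    exact integral_congr_ae (ae_of_all _ fun x => by simp only [hw]; ring)
  simp only [condHess, hupd]
  rw [hess'_log_gaussSmooth hσ hw0 hw1 hw2 hwpos (hpos n _), e0, e1, e1, e2]

/-- Cauchy–Schwarz, in the form obtained from the tangent line of `a ↦ a ^ 2 / b`. -/
lemma two_mul_mul_sub_le_sq_div {a b : ℝ} (hb : 0 < b) (t : ℝ) :
    2 * t * a - t ^ 2 * b ≤ a ^ 2 / b := by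
  rw [le_div_iff₀ hb]
  nlinarith [sq_nonneg (a - t * b)]

lemma jointD_sq_div_le (hσ : 0 < σ) (hp0 : ∀ x, 0 ≤ p x) (hpi : Integrable p)
    (hpos : ∀ (n : ℕ) (y : Fin n → Fin d → ℝ), 0 < jointD p σ n y) {f : (Fin d → ℝ) → ℝ}
    (hf : Integrable fun x => p x * f x) (hf2 : Integrable fun x => p x * f x ^ 2)
    (n : ℕ) (y : Fin n → Fin d → ℝ) :
    jointD (fun x => p x * f x) σ n y ^ 2 / jointD p σ n y ≤
      jointD (fun x => p x * f x ^ 2) σ n y := by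
  have hB0 := hpos n y
  have key (t : ℝ) : 2 * t * jointD (fun x => p x * f x) σ n y - t ^ 2 * jointD p σ n y ≤
      jointD (fun x => p x * f x ^ 2) σ n y := by
    have ha := (integrable_mul_prod_gKer hσ hf n y).const_mul (2 * t)
    have hb := (integrable_mul_prod_gKer hσ hpi n y).const_mul (t ^ 2)
    simp only [jointD]
    rw [← integral_const_mul, ← integral_const_mul, ← integral_sub ha hb]
    refine integral_mono (ha.sub hb) (integrable_mul_prod_gKer hσ hf2 n y) fun x => ?_
    have hK : 0 ≤ p x * ∏ k, gKer d σ x (y k) :=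
      mul_nonneg (hp0 x) (Finset.prod_nonneg fun k _ => (gKer_pos hσ _ _).le)
    simp only
    nlinarith [mul_nonneg hK (sq_nonneg (f x - t))]
  refine le_trans (le_of_eq ?_)
    (key (jointD (fun x => p x * f x) σ n y / jointD p σ n y))
  field_simp
  ring

lemma integrable_jointD_sq_div (hσ : 0 < σ) (hp0 : ∀ x, 0 ≤ p x) (hpi : Integrable p)
    (hpos : ∀ (n : ℕ) (y : Fin n → Fin d → ℝ), 0 < jointD p σ n y) {f : (Fin d → ℝ) → ℝ}
    (hf : Integrable fun x => p x * f x) (hf2 : Integrable fun x => p x * f x ^ 2) (n : ℕ) :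
    Integrable fun y => jointD (fun x => p x * f x) σ n y ^ 2 / jointD p σ n y := by
  refine (integrable_jointD hσ hf2 n).1.mono'
    (((integrable_jointD hσ hf n).1.aestronglyMeasurable.aemeasurable.pow_const 2).div
      (integrable_jointD hσ hpi n).1.aestronglyMeasurable.aemeasurable).aestronglyMeasurable
    (ae_of_all _ fun y => ?_)
  rw [Real.norm_of_nonneg (div_nonneg (sq_nonneg _) (hpos n y).le)]
  exact jointD_sq_div_le hσ hp0 hpi hpos hf hf2 n y

/-- An additional measurement increases the second moment of the posterior mean of `f`. -/
lemma integral_jointD_sq_div_le_succ (hσ : 0 < σ) (hp0 : ∀ x, 0 ≤ p x) (hpi : Integrable p)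
    (hpos : ∀ (n : ℕ) (y : Fin n → Fin d → ℝ), 0 < jointD p σ n y) {f : (Fin d → ℝ) → ℝ}
    (hf : Integrable fun x => p x * f x) (hf2 : Integrable fun x => p x * f x ^ 2) (n : ℕ) :
    ∫ y, jointD (fun x => p x * f x) σ n y ^ 2 / jointD p σ n y ≤
      ∫ y, jointD (fun x => p x * f x) σ (n + 1) y ^ 2 / jointD p σ (n + 1) y := by
  set e := (MeasurableEquiv.piFinSuccAbove (fun _ : Fin (n + 1) => Fin d → ℝ)
    (Fin.last n)).symm with he
  have hmp : MeasurePreserving e :=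
    (volume_preserving_piFinSuccAbove (fun _ => Fin d → ℝ) (Fin.last n)).symm _
  set φ : (Fin (n + 1) → Fin d → ℝ) → ℝ :=
    fun y => jointD (fun x => p x * f x) σ (n + 1) y ^ 2 / jointD p σ (n + 1) y with hφ
  have hφi : Integrable φ := integrable_jointD_sq_div hσ hp0 hpi hpos hf hf2 (n + 1)
  have hφe : Integrable (fun q => φ (e q)) (volume.prod volume) :=
    (hmp.integrable_comp_emb e.measurableEmbedding).2 hφi
  have hsplit : ∫ y, φ y = ∫ y, ∫ z, φ (e (z, y)) := by
    rw [← hmp.integral_comp e.measurableEmbedding φ]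
    exact integral_prod_symm _ hφe
  rw [hsplit]
  refine integral_mono_ae (integrable_jointD_sq_div hσ hp0 hpi hpos hf hf2 n)
    hφe.integral_prod_right ?_
  filter_upwards [hφe.prod_left_ae] with y hy
  obtain ⟨hai, hae⟩ := jointD_marginal hσ hf n y
  obtain ⟨hbi, hbe⟩ := jointD_marginal hσ hpi n y
  have hB0 : 0 < jointD p σ n y := hpos n y
  set t := jointD (fun x => p x * f x) σ n y / jointD p σ n y with ht
  calc jointD (fun x => p x * f x) σ n y ^ 2 / jointD p σ n y
      = 2 * t * jointD (fun x => p x * f x) σ n y - t ^ 2 * jointD p σ n y := by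
        rw [ht]
        field_simp
        ring
    _ ≤ ∫ z, φ (e (z, y)) := by
        rw [← hae, ← hbe, ← integral_const_mul, ← integral_const_mul,
          ← integral_sub (hai.const_mul _) (hbi.const_mul _)]
        exact integral_mono ((hai.const_mul _).sub (hbi.const_mul _)) hy fun z =>
          two_mul_mul_sub_le_sq_div (hpos _ _) t

lemma integrable_jointD_mul_div (hσ : 0 < σ) (hp0 : ∀ x, 0 ≤ p x) (hpi : Integrable p)
    (hpos : ∀ (n : ℕ) (y : Fin n → Fin d → ℝ), 0 < jointD p σ n y)
    {f g : (Fin d → ℝ) → ℝ}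
    (hf : Integrable fun x => p x * f x) (hf2 : Integrable fun x => p x * f x ^ 2)
    (hg : Integrable fun x => p x * g x) (hg2 : Integrable fun x => p x * g x ^ 2) (n : ℕ) :
    Integrable fun y => jointD (fun x => p x * f x) σ n y *
      jointD (fun x => p x * g x) σ n y / jointD p σ n y := by
  have hm {h : (Fin d → ℝ) → ℝ} (hh : Integrable h) : AEMeasurable (jointD h σ n) :=
    (integrable_jointD hσ hh n).1.aestronglyMeasurable.aemeasurable
  refine ((integrable_jointD_sq_div hσ hp0 hpi hpos hf hf2 n).add
    (integrable_jointD_sq_div hσ hp0 hpi hpos hg hg2 n)).mono'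
    (((hm hf).mul (hm hg)).div (hm hpi)).aestronglyMeasurable (ae_of_all _ fun y => ?_)
  have hB := hpos n y
  rw [Real.norm_eq_abs, abs_div, abs_of_pos hB, Pi.add_apply, ← add_div]
  gcongr
  rw [abs_le]
  constructor <;>
  nlinarith [sq_nonneg (jointD (fun x => p x * f x) σ n y + jointD (fun x => p x * g x) σ n y),
    sq_nonneg (jointD (fun x => p x * f x) σ n y - jointD (fun x => p x * g x) σ n y),
    sq_nonneg (jointD (fun x => p x * f x) σ n y), sq_nonneg (jointD (fun x => p x * g x) σ n y)]

lemma integrable_mul_of_sq_growth (hp0 : ∀ x, 0 ≤ p x) (hpi : Integrable p)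
    (hmom2 : Integrable fun x : Fin d → ℝ => p x * ∑ i, x i ^ 2) {f : (Fin d → ℝ) → ℝ}
    (hf : Continuous f) (hle : ∀ x, |f x| ≤ 1 + ∑ i, x i ^ 2) :
    Integrable fun x => p x * f x := by
  refine (hpi.add hmom2).mono' (hpi.aestronglyMeasurable.mul hf.aestronglyMeasurable)
    (ae_of_all _ fun x => ?_)
  rw [Real.norm_eq_abs, abs_mul, abs_of_nonneg (hp0 x), Pi.add_apply]
  nlinarith [mul_le_mul_of_nonneg_left (hle x) (hp0 x)]

lemma avgHess_apply (hσ : 0 < σ) (hp0 : ∀ x, 0 ≤ p x) (hpi : Integrable p)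
    (hp1 : ∫ x, p x = 1) (h1 : ∀ i, Integrable fun x => p x * x i)
    (h2 : ∀ i j, Integrable fun x => p x * (x i * x j))
    (hpos : ∀ (n : ℕ) (y : Fin n → Fin d → ℝ), 0 < jointD p σ n y) (n : ℕ) (i j : Fin d) :
    avgHess p σ n i j = (σ ^ 4)⁻¹ * (∫ x, p x * (x i * x j)) -
      (σ ^ 2)⁻¹ * (if i = j then 1 else 0) -
      (σ ^ 4)⁻¹ * ∫ y, jointD (fun x => p x * x i) σ (n + 1) y *
        jointD (fun x => p x * x j) σ (n + 1) y / jointD p σ (n + 1) y := by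
  have hsq (i : Fin d) : Integrable fun x => p x * x i ^ 2 := by
    simpa only [sq] using h2 i i
  obtain ⟨hi2, he2⟩ := integrable_jointD hσ (h2 i j) (n + 1)
  obtain ⟨hi0, he0⟩ := integrable_jointD hσ hpi (n + 1)
  have hi1 := integrable_jointD_mul_div hσ hp0 hpi hpos (h1 i) (hsq i) (h1 j) (hsq j) (n + 1)
  rw [hp1] at he0
  have hpt (y : Fin (n + 1) → Fin d → ℝ) : jointD p σ (n + 1) y * condHess p σ n y i j =
      (σ ^ 4)⁻¹ * jointD (fun x => p x * (x i * x j)) σ (n + 1) y -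
      (σ ^ 2)⁻¹ * (if i = j then 1 else 0) * jointD p σ (n + 1) y -
      (σ ^ 4)⁻¹ * (jointD (fun x => p x * x i) σ (n + 1) y *
        jointD (fun x => p x * x j) σ (n + 1) y / jointD p σ (n + 1) y) := by
    rw [condHess_apply hσ hpi h1 h2 hpos]
    have := (hpos (n + 1) y).ne'
    field_simp
    ring
  simp only [avgHess, Matrix.of_apply, hpt]
  have hi20 : Integrable fun y => (σ ^ 4)⁻¹ * jointD (fun x => p x * (x i * x j)) σ (n + 1) y -
      (σ ^ 2)⁻¹ * (if i = j then 1 else 0) * jointD p σ (n + 1) y :=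
    (hi2.const_mul _).sub (hi0.const_mul _)
  rw [integral_sub hi20 (hi1.const_mul _),
    integral_sub (hi2.const_mul _) (hi0.const_mul _), integral_const_mul, integral_const_mul,
    integral_const_mul, he2, he0, mul_one]

lemma jointD_linear (hσ : 0 < σ) (h1 : ∀ i, Integrable fun x => p x * x i) (v : Fin d → ℝ)
    (n : ℕ) (y : Fin n → Fin d → ℝ) :
    jointD (fun x => p x * ∑ i, v i * x i) σ n y =
      ∑ i, v i * jointD (fun x => p x * x i) σ n y := by
  simp only [jointD, ← integral_const_mul]
  rw [← integral_finsetSum _ fun i _ => (integrable_mul_prod_gKer hσ (h1 i) n y).const_mul _]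
  refine integral_congr_ae (ae_of_all _ fun x => ?_)
  simp only [Finset.mul_sum, Finset.sum_mul]
  exact Finset.sum_congr rfl fun i _ => by ring

/-- Second moment of the posterior mean of a linear functional, as a quadratic form. -/
lemma integral_jointD_linear_sq_div (hσ : 0 < σ) (hp0 : ∀ x, 0 ≤ p x) (hpi : Integrable p)
    (h1 : ∀ i, Integrable fun x => p x * x i)
    (h2 : ∀ i j, Integrable fun x => p x * (x i * x j))
    (hpos : ∀ (n : ℕ) (y : Fin n → Fin d → ℝ), 0 < jointD p σ n y) (v : Fin d → ℝ) (n : ℕ) :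
    ∫ y, jointD (fun x => p x * ∑ i, v i * x i) σ n y ^ 2 / jointD p σ n y =
      ∑ i, ∑ j, v i * v j * ∫ y, jointD (fun x => p x * x i) σ n y *
        jointD (fun x => p x * x j) σ n y / jointD p σ n y := by
  have hsq (i : Fin d) : Integrable fun x => p x * x i ^ 2 := by
    simpa only [sq] using h2 i i
  have hi (i j : Fin d) := (integrable_jointD_mul_div hσ hp0 hpi hpos (h1 i) (hsq i) (h1 j)
    (hsq j) n).const_mul (v i * v j)
  simp only [← integral_const_mul]
  rw [Finset.sum_congr rfl fun i _ => (integral_finsetSum _ fun j _ => hi i j).symm,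
    ← integral_finsetSum _ fun i _ => integrable_finsetSum _ fun j _ => hi i j]
  refine integral_congr_ae (ae_of_all _ fun y => ?_)
  simp only [jointD_linear hσ h1, sq, Finset.sum_mul_sum, Finset.sum_div]
  exact Finset.sum_congr rfl fun i _ => Finset.sum_congr rfl fun j _ => by ring

end Moments

/-- The averaged conditional Hessians are monotone non-increasing in Loewner order:
`𝔼[∇²_{y₁} log p(y₁)] ≽ 𝔼[∇²_{y₂} log p(y₂|y₁)] ≽ ⋯ ≽ 𝔼[∇²_{y_m} log p(y_m|y_{1:m−1})]`. -/
theorem stmt11 (d m : ℕ) (σ : ℝ) (hσ : 0 < σ) (p : (Fin d → ℝ) → ℝ)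
    (hp0 : ∀ x, 0 ≤ p x) (hpi : Integrable p) (hp1 : ∫ x, p x = 1)
    (hmom2 : Integrable fun x : Fin d → ℝ => p x * ∑ i, x i ^ 2)
    (hpos : ∀ (n : ℕ) (y : Fin n → Fin d → ℝ), 0 < jointD p σ n y) :
    ∀ n : ℕ, n + 2 ≤ m → (avgHess p σ n - avgHess p σ (n + 1)).PosSemidef := by
  intro n _
  have hnn (x : Fin d → ℝ) : ∀ i ∈ Finset.univ, 0 ≤ x i ^ 2 := fun i _ => sq_nonneg _
  have hle (x : Fin d → ℝ) (i : Fin d) : x i ^ 2 ≤ ∑ i, x i ^ 2 :=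
    Finset.single_le_sum (hnn x) (Finset.mem_univ i)
  have h1 (i : Fin d) : Integrable fun x => p x * x i := by
    refine integrable_mul_of_sq_growth hp0 hpi hmom2 (continuous_apply i) fun x => ?_
    rw [abs_le]
    constructor <;> nlinarith [hle x i, sq_nonneg (x i - 1), sq_nonneg (x i + 1)]
  have h2 (i j : Fin d) : Integrable fun x => p x * (x i * x j) := by
    refine integrable_mul_of_sq_growth hp0 hpi hmom2
      ((continuous_apply i).mul (continuous_apply j)) fun x => ?_
    rw [abs_le]
    constructor <;>
    nlinarith [hle x i, hle x j, sq_nonneg (x i - x j), sq_nonneg (x i + x j)]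
  have happly := avgHess_apply hσ hp0 hpi hp1 h1 h2 hpos
  refine Matrix.PosSemidef.of_dotProduct_mulVec_nonneg ?_ fun v => ?_
  · ext i j
    simp only [Matrix.conjTranspose_apply, Matrix.sub_apply, happly, star_trivial,
      mul_comm (jointD (fun x => p x * x j) σ _ _)]
    ring
  · have hf : Integrable fun x => p x * ∑ i, v i * x i := by
      simp only [Finset.mul_sum, mul_left_comm (p _)]
      exact integrable_finsetSum _ fun i _ => (h1 i).const_mul _
    have hf2 : Integrable fun x => p x * (∑ i, v i * x i) ^ 2 := by
      simp only [sq, Finset.sum_mul_sum]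
      simp only [Finset.mul_sum]
      refine integrable_finsetSum _ fun i _ => integrable_finsetSum _ fun j _ => ?_
      exact ((h2 i j).const_mul (v i * v j)).congr (ae_of_all _ fun x => by simp only; ring)
    have hmono := integral_jointD_sq_div_le_succ hσ hp0 hpi hpos hf hf2 (n + 1)
    rw [integral_jointD_linear_sq_div hσ hp0 hpi h1 h2 hpos,
      integral_jointD_linear_sq_div hσ hp0 hpi h1 h2 hpos] at hmono
    have h := mul_nonneg (inv_nonneg.2 (pow_pos hσ 4).le) (sub_nonneg.2 hmono)
    refine h.trans_eq ?_
    simp only [dotProduct, Matrix.mulVec, Matrix.sub_apply, happly, star_trivial,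
      ← Finset.sum_sub_distrib, Finset.mul_sum]
    exact Finset.sum_congr rfl fun i _ => Finset.sum_congr rfl fun j _ => by ring

end
end

section
/- Let Z be a random vector in ℝ^d with ‖Z‖ ≤ R almost surely, X = Z + N₀ with N₀ ~ N(0, τ²I), and Y_k = X + N_k with N_k ~ N(0, σ²I) i.i.d., all independent. Then for every m ≥ 1 and all y_{1:m}, ∇²_{y_m} log p(y_m | y_{1:m−1}) ≼ ζ(m)·I, where ζ(m) = (1/σ²)(τ²/(mτ² + σ²) − 1) + R²/(mτ² + σ²)². -/
open MeasureTheory Real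

noncomputable section

section

variable {d : ℕ}

/-- The weighted exponential integral `∫ f(u) exp(c⟨u, z⟩) dμ(u)`. -/
def expInt (μ : Measure (Fin d → ℝ)) (c : ℝ) (f : (Fin d → ℝ) → ℝ) (z : Fin d → ℝ) : ℝ :=
  ∫ u, f u * Real.exp (c * ∑ i, u i * z i) ∂μ

lemma integrable_of_continuous_of_ae_sq_le {μ : Measure (Fin d → ℝ)} [IsFiniteMeasure μ] {R : ℝ}
    (hμ : ∀ᵐ z ∂μ, ∑ i, z i ^ 2 ≤ R ^ 2) {f : (Fin d → ℝ) → ℝ} (hf : Continuous f) :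
    Integrable f μ := by
  have hK : ∀ᵐ z ∂μ, z ∈ Metric.closedBall (0 : Fin d → ℝ) |R| := by
    filter_upwards [hμ] with z hz
    rw [mem_closedBall_zero_iff, pi_norm_le_iff_of_nonneg (abs_nonneg R)]
    intro i
    rw [Real.norm_eq_abs, ← sq_le_sq]
    exact (Finset.single_le_sum (f := fun i => z i ^ 2) (fun i _ => sq_nonneg _)
      (Finset.mem_univ i)).trans hz
  rw [← Measure.restrict_eq_self_of_ae_mem hK]
  exact hf.continuousOn.integrableOn_compact (isCompact_closedBall _ _)

/-- The continuous linear functional `v ↦ c⟨u, v⟩`. -/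
def scaledDot (c : ℝ) (u : Fin d → ℝ) : (Fin d → ℝ) →L[ℝ] ℝ :=
  ∑ i, (c * u i) • ContinuousLinearMap.proj (R := ℝ) (φ := fun _ : Fin d => ℝ) i

lemma scaledDot_apply (c : ℝ) (u v : Fin d → ℝ) : scaledDot c u v = c * ∑ i, u i * v i := by
  simp [scaledDot, Finset.mul_sum, mul_assoc]

lemma continuous_scaledDot (c : ℝ) : Continuous (scaledDot (d := d) c) := by
  unfold scaledDot
  fun_prop

lemma hasFDerivAt_expInt {μ : Measure (Fin d → ℝ)} [IsFiniteMeasure μ] {R : ℝ}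
    (hμ : ∀ᵐ z ∂μ, ∑ i, z i ^ 2 ≤ R ^ 2) (c : ℝ) {f : (Fin d → ℝ) → ℝ} (hf : Continuous f)
    (z : Fin d → ℝ) :
    ∃ L : (Fin d → ℝ) →L[ℝ] ℝ, HasFDerivAt (expInt μ c f) L z ∧
      ∀ i, L (Pi.single i 1) = expInt μ c (fun u => f u * (c * u i)) z := by
  have hcont := continuous_scaledDot (d := d) c
  have hF : ∀ w : Fin d → ℝ, Continuous fun u : Fin d → ℝ => f u * Real.exp (scaledDot c u w) :=
    fun w => hf.mul (Real.continuous_exp.comp (hcont.clm_apply continuous_const))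
  have hF' : ∀ w : Fin d → ℝ, Continuous fun u : Fin d → ℝ =>
      (f u * Real.exp (scaledDot c u w)) • scaledDot c u := fun w => (hF w).smul hcont
  have hbound : Continuous fun u : Fin d → ℝ =>
      |f u| * Real.exp (‖scaledDot c u‖ * (‖z‖ + 1)) * ‖scaledDot c u‖ := by fun_prop
  have key := hasFDerivAt_integral_of_dominated_of_fderiv_le (𝕜 := ℝ) (μ := μ)
    (F := fun w u => f u * Real.exp (scaledDot c u w))
    (F' := fun w u => (f u * Real.exp (scaledDot c u w)) • scaledDot c u)
    (x₀ := z) (s := Metric.ball z 1)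
    (bound := fun u => |f u| * Real.exp (‖scaledDot c u‖ * (‖z‖ + 1)) * ‖scaledDot c u‖)
    (Metric.ball_mem_nhds z one_pos)
    (.of_forall fun w => (hF w).aestronglyMeasurable)
    (integrable_of_continuous_of_ae_sq_le hμ (hF z))
    (hF' z).aestronglyMeasurable
    (.of_forall fun u w hw => by
      rw [norm_smul, norm_mul, Real.norm_eq_abs, Real.norm_eq_abs, Real.abs_exp]
      gcongr
      refine (le_abs_self _).trans (((scaledDot c u).le_opNorm w).trans ?_)
      gcongr
      have h1 : ‖w - z‖ < 1 := by simpa [dist_eq_norm] using hw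
      have h2 := norm_le_norm_add_norm_sub z w
      rw [norm_sub_rev] at h2
      linarith)
    (integrable_of_continuous_of_ae_sq_le hμ hbound)
    (.of_forall fun u w _ => by
      have h := ((scaledDot c u).hasFDerivAt (x := w)).exp.const_mul (f u)
      rwa [smul_smul] at h)
  refine ⟨∫ u, (f u * Real.exp (scaledDot c u z)) • scaledDot c u ∂μ, ?_, fun i => ?_⟩
  · have hfun : expInt μ c f = fun w => ∫ u, f u * Real.exp (scaledDot c u w) ∂μ := by
      funext w
      simp only [expInt, scaledDot_apply]
    rw [hfun]
    exact key
  · have hint : Integrable (fun u => (f u * Real.exp (scaledDot c u z)) • scaledDot c u) μ := by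
      refine Integrable.mono' (integrable_of_continuous_of_ae_sq_le hμ (hF' z).norm)
        (hF' z).aestronglyMeasurable (.of_forall fun u => le_rfl)
    rw [ContinuousLinearMap.integral_apply hint, expInt]
    refine integral_congr_ae (.of_forall fun u => ?_)
    simp [scaledDot_apply, Pi.single_apply]
    ring

lemma expInt_pos {μ : Measure (Fin d → ℝ)} [IsFiniteMeasure μ] [NeZero μ] {R : ℝ}
    (hμ : ∀ᵐ z ∂μ, ∑ i, z i ^ 2 ≤ R ^ 2) {w : (Fin d → ℝ) → ℝ} (hw : Continuous w)
    (hw0 : ∀ u, 0 < w u) (c : ℝ) (z : Fin d → ℝ) : 0 < expInt μ c w z := by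
  have hp : ∀ u : Fin d → ℝ, 0 < w u * Real.exp (c * ∑ i, u i * z i) :=
    fun u => mul_pos (hw0 u) (Real.exp_pos _)
  refine (integral_pos_iff_support_of_nonneg (fun u => (hp u).le)
    (integrable_of_continuous_of_ae_sq_le hμ (by fun_prop))).2 ?_
  rw [Function.support_eq_univ (fun u => (hp u).ne')]
  exact Measure.measure_univ_pos.2 (NeZero.ne μ)

lemma hess'_log_ratio {μ : Measure (Fin d → ℝ)} [IsFiniteMeasure μ] [NeZero μ] {R : ℝ}
    (hμ : ∀ᵐ z ∂μ, ∑ i, z i ^ 2 ≤ R ^ 2) {w : (Fin d → ℝ) → ℝ} (hw : Continuous w)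
    (hw0 : ∀ u, 0 < w u) (α c c₀ : ℝ) (b y : Fin d → ℝ) (i j : Fin d) :
    hess' (fun z => c₀ + ∑ k, (α / 2 * z k ^ 2 + b k * z k) + Real.log (expInt μ c w z)) y i j =
      α * (1 : Matrix (Fin d) (Fin d) ℝ) i j +
        (expInt μ c (fun u => w u * (c * u j) * (c * u i)) y * expInt μ c w y -
          expInt μ c (fun u => w u * (c * u i)) y * expInt μ c (fun u => w u * (c * u j)) y) /
        expInt μ c w y ^ 2 := by
  have hpos : ∀ z, 0 < expInt μ c w z := expInt_pos hμ hw hw0 c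
  have hgrad : (fun z => fderiv ℝ (fun z => c₀ + ∑ k, (α / 2 * z k ^ 2 + b k * z k)
      + Real.log (expInt μ c w z)) z (Pi.single j 1)) =
      fun z => α * z j + b j + expInt μ c (fun u => w u * (c * u j)) z / expInt μ c w z := by
    funext z
    obtain ⟨L, hL, hLi⟩ := hasFDerivAt_expInt hμ c hw z
    have hq : HasFDerivAt (fun z : Fin d → ℝ => ∑ k, (α / 2 * z k ^ 2 + b k * z k))
        (∑ k, (α * z k + b k) • ContinuousLinearMap.proj (R := ℝ) (φ := fun _ : Fin d => ℝ) k)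
        z := by
      refine HasFDerivAt.fun_sum fun k _ => ?_
      have hk := hasFDerivAt_apply (𝕜 := ℝ) k z
      refine (((hk.pow 2).const_mul (α / 2)).add (hk.const_mul (b k))).congr_fderiv ?_
      ext v
      simp
      ring
    rw [((hq.const_add c₀).fun_add (hL.log (hpos z).ne')).fderiv]
    simp [hLi, Pi.single_apply]
    ring
  obtain ⟨L, hL, hLi⟩ := hasFDerivAt_expInt hμ c hw y
  obtain ⟨L', hL', hLi'⟩ :=
    hasFDerivAt_expInt hμ c (f := fun u => w u * (c * u j)) (by fun_prop) y
  rw [hess', Matrix.of_apply, hgrad]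
  have hj := hasFDerivAt_apply (𝕜 := ℝ) j y
  have hdiv := hL'.mul ((hasDerivAt_inv (hpos y).ne').comp_hasFDerivAt y hL)
  have htot := ((hj.const_mul α).add_const (b j)).add hdiv
  have heq : (fun z => α * z j + b j + expInt μ c (fun u => w u * (c * u j)) z / expInt μ c w z)
    = (fun z => α * z j + b j) +
      (expInt μ c (fun u => w u * (c * u j)) * ((fun x => x⁻¹) ∘ expInt μ c w)) := by
    funext z
    simp [div_eq_mul_inv]
  rw [heq, htot.fderiv]
  have hne := (hpos y).ne'
  simp [hLi, hLi', Pi.single_apply, Matrix.one_apply, eq_comm (a := i)]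
  generalize expInt μ c (fun u => w u * (c * u j) * (c * u i)) y = B
  generalize expInt μ c (fun u => w u * (c * u j)) y = Aj
  generalize expInt μ c (fun u => w u * (c * u i)) y = Ai
  field_simp
  ring

lemma expInt_sum {μ : Measure (Fin d → ℝ)} [IsFiniteMeasure μ] {R : ℝ}
    (hμ : ∀ᵐ z ∂μ, ∑ i, z i ^ 2 ≤ R ^ 2) {ι : Type*} (s : Finset ι) (c : ℝ) (a : ι → ℝ)
    {f : ι → (Fin d → ℝ) → ℝ} (hf : ∀ i, Continuous (f i)) (z : Fin d → ℝ) :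
    ∑ i ∈ s, a i * expInt μ c (f i) z = expInt μ c (fun u => ∑ i ∈ s, a i * f i u) z := by
  have hI : ∀ i, Integrable (fun u => a i * (f i u * Real.exp (c * ∑ k, u k * z k))) μ := by
    intro i
    have := hf i
    exact integrable_of_continuous_of_ae_sq_le hμ (by fun_prop)
  simp only [expInt, Finset.sum_mul, ← integral_const_mul]
  rw [← integral_finsetSum _ fun i _ => hI i]
  simp only [mul_assoc]

/-- The Hessian of a quadratic plus the logarithm of a Laplace transform of a measure supported
in the ball of radius `R` is at most `α + c²R²`. -/
lemma posSemidef_sub_hess' {μ : Measure (Fin d → ℝ)} [IsFiniteMeasure μ] [NeZero μ] {R : ℝ}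
    (hμ : ∀ᵐ z ∂μ, ∑ i, z i ^ 2 ≤ R ^ 2) {w : (Fin d → ℝ) → ℝ} (hw : Continuous w)
    (hw0 : ∀ u, 0 < w u) (α c c₀ : ℝ) (b y : Fin d → ℝ) :
    ((α + c ^ 2 * R ^ 2) • (1 : Matrix (Fin d) (Fin d) ℝ) -
      hess' (fun z => c₀ + ∑ k, (α / 2 * z k ^ 2 + b k * z k)
        + Real.log (expInt μ c w z)) y).PosSemidef := by
  have hpos := expInt_pos hμ hw hw0 c y
  refine .of_dotProduct_mulVec_nonneg ?_ fun x => ?_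
  · ext i j
    simp only [Matrix.conjTranspose_apply, Matrix.sub_apply, Matrix.smul_apply,
      hess'_log_ratio hμ hw hw0, star_trivial, Matrix.one_apply, eq_comm (a := i)]
    simp only [mul_right_comm, mul_comm (expInt μ c (fun u => w u * (c * u j)) y)]
  · set P := expInt μ c w y
    set A : Fin d → ℝ := fun i => expInt μ c (fun u => w u * (c * u i)) y
    set B : Fin d → Fin d → ℝ := fun i j => expInt μ c (fun u => w u * (c * u j) * (c * u i)) y
    have hquad : star x ⬝ᵥ (((α + c ^ 2 * R ^ 2) • (1 : Matrix (Fin d) (Fin d) ℝ) -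
        hess' (fun z => c₀ + ∑ k, (α / 2 * z k ^ 2 + b k * z k)
          + Real.log (expInt μ c w z)) y).mulVec x) =
        (c ^ 2 * R ^ 2 * (∑ i, x i ^ 2) * P - ∑ i, ∑ j, x i * x j * B i j) / P +
          (∑ i, x i * A i) ^ 2 / P ^ 2 := by
      have hx : ∀ i, ∑ j, (((α + c ^ 2 * R ^ 2) • (1 : Matrix (Fin d) (Fin d) ℝ) -
        hess' (fun z => c₀ + ∑ k, (α / 2 * z k ^ 2 + b k * z k)
          + Real.log (expInt μ c w z)) y) i j) * x j =
          c ^ 2 * R ^ 2 * x i - ∑ j, x j * B i j / P + ∑ j, A i * (x j * A j) / P ^ 2 := by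
        intro i
        have : c ^ 2 * R ^ 2 * x i
            = ∑ j, c ^ 2 * R ^ 2 * (1 : Matrix (Fin d) (Fin d) ℝ) i j * x j := by
          simp [Matrix.one_apply]
        rw [this, ← Finset.sum_sub_distrib, ← Finset.sum_add_distrib]
        refine Finset.sum_congr rfl fun j _ => ?_
        rw [Matrix.sub_apply, Matrix.smul_apply, hess'_log_ratio hμ hw hw0]
        change (_ - (_ + (B i j * P - A i * A j) / P ^ 2)) * _ = _
        rw [smul_eq_mul]
        field_simp
        ring
      simp only [dotProduct, Matrix.mulVec, star_trivial, hx]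
      simp only [mul_add, mul_sub, Finset.sum_add_distrib, Finset.sum_sub_distrib]
      rw [sub_div, mul_div_cancel_right₀ _ hpos.ne']
      congr 1
      · congr 1
        · rw [Finset.mul_sum]
          exact Finset.sum_congr rfl fun i _ => by ring
        · rw [Finset.sum_div]
          refine Finset.sum_congr rfl fun i _ => ?_
          rw [Finset.mul_sum, Finset.sum_div]
          exact Finset.sum_congr rfl fun j _ => by ring
      · rw [sq (∑ i, x i * A i), Finset.sum_mul_sum, Finset.sum_div]
        refine Finset.sum_congr rfl fun i _ => ?_
        rw [Finset.mul_sum, Finset.sum_div]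
        exact Finset.sum_congr rfl fun j _ => by ring
    rw [hquad]
    have hB : ∑ i, ∑ j, x i * x j * B i j =
        expInt μ c (fun u => w u * (c ^ 2 * (∑ i, u i * x i) ^ 2)) y := by
      rw [← Finset.sum_product', expInt_sum hμ _ c (fun p : Fin d × Fin d => x p.1 * x p.2)
        (f := fun p u => w u * (c * u p.2) * (c * u p.1)) (fun p => by fun_prop)]
      congr 1
      funext u
      rw [sq (∑ i, u i * x i), Finset.sum_mul_sum, ← Finset.sum_product', Finset.mul_sum,
        Finset.mul_sum]
      exact Finset.sum_congr rfl fun p _ => by ring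
    have hBle : ∑ i, ∑ j, x i * x j * B i j ≤ c ^ 2 * R ^ 2 * (∑ i, x i ^ 2) * P := by
      rw [hB]
      simp only [P, expInt]
      rw [← integral_const_mul]
      refine integral_mono_ae (integrable_of_continuous_of_ae_sq_le hμ (by fun_prop))
        (integrable_of_continuous_of_ae_sq_le hμ (by fun_prop)) ?_
      filter_upwards [hμ] with u hu
      have hcs : (∑ i, u i * x i) ^ 2 ≤ R ^ 2 * ∑ i, x i ^ 2 :=
        (Finset.sum_mul_sq_le_sq_mul_sq _ _ _).trans
          (mul_le_mul_of_nonneg_right hu (Finset.sum_nonneg fun i _ => sq_nonneg _))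
      have h1 : 0 ≤ c ^ 2 * (w u * Real.exp (c * ∑ k, u k * y k)) :=
        mul_nonneg (sq_nonneg _) (mul_nonneg (hw0 u).le (Real.exp_pos _).le)
      have := mul_le_mul_of_nonneg_left hcs h1
      linarith
    exact add_nonneg (div_nonneg (sub_nonneg.2 hBle) hpos.le) (by positivity)

lemma gKer_mul_prod_gKer {σ τ : ℝ} (hσ : 0 < σ) (hτ : 0 < τ) (m : ℕ) (u x : Fin d → ℝ)
    (y : Fin m → Fin d → ℝ) :
    gKer d τ u x * ∏ k, gKer d σ x (y k) =
      (2 * π * τ ^ 2) ^ (-(d : ℝ) / 2) * ((2 * π * σ ^ 2) ^ (-(d : ℝ) / 2)) ^ m *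
        Real.exp (∑ i, (τ ^ 2 / (2 * σ ^ 2 * (m * τ ^ 2 + σ ^ 2)) * (∑ k, y k i) ^ 2
          - (∑ k, y k i ^ 2) / (2 * σ ^ 2))) *
        (Real.exp (-(m : ℝ) / (2 * (m * τ ^ 2 + σ ^ 2)) * ∑ i, u i ^ 2) *
          Real.exp (1 / (m * τ ^ 2 + σ ^ 2) * ∑ i, u i * ∑ k, y k i)) *
        Real.exp (-((m * τ ^ 2 + σ ^ 2) / (2 * σ ^ 2 * τ ^ 2)) *
          ∑ i, (x i - (σ ^ 2 * u i + τ ^ 2 * ∑ k, y k i) / (m * τ ^ 2 + σ ^ 2)) ^ 2) := by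
  simp only [gKer, Finset.prod_mul_distrib, Finset.prod_const, Finset.card_univ, Fintype.card_fin,
    ← Real.exp_sum]
  have hexp : -sqDist u x / (2 * τ ^ 2) + ∑ k, -sqDist x (y k) / (2 * σ ^ 2) =
      (∑ i, (τ ^ 2 / (2 * σ ^ 2 * (m * τ ^ 2 + σ ^ 2)) * (∑ k, y k i) ^ 2
          - (∑ k, y k i ^ 2) / (2 * σ ^ 2))) +
        (-(m : ℝ) / (2 * (m * τ ^ 2 + σ ^ 2)) * (∑ i, u i ^ 2) +
          1 / (m * τ ^ 2 + σ ^ 2) * (∑ i, u i * ∑ k, y k i)) +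
        -((m * τ ^ 2 + σ ^ 2) / (2 * σ ^ 2 * τ ^ 2)) *
          ∑ i, (x i - (σ ^ 2 * u i + τ ^ 2 * ∑ k, y k i) / (m * τ ^ 2 + σ ^ 2)) ^ 2 := by
    have hk : ∑ k, -sqDist x (y k) / (2 * σ ^ 2) =
        ∑ i, -(m * x i ^ 2 - 2 * x i * (∑ k, y k i) + ∑ k, y k i ^ 2) / (2 * σ ^ 2) := by
      rw [← Finset.sum_div, ← Finset.sum_div]
      congr 1
      simp only [sqDist, Finset.sum_neg_distrib]
      rw [Finset.sum_comm]
      congr 1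
      refine Finset.sum_congr rfl fun i _ => ?_
      simp only [sub_sq, Finset.sum_add_distrib, Finset.sum_sub_distrib, Finset.mul_sum,
        Finset.sum_const, Finset.card_univ, Fintype.card_fin, nsmul_eq_mul]
    rw [hk, sqDist, ← Finset.sum_neg_distrib, Finset.sum_div]
    simp only [Finset.mul_sum (s := (Finset.univ : Finset (Fin d))), ← Finset.sum_add_distrib]
    refine Finset.sum_congr rfl fun i _ => ?_
    generalize ∑ k, y k i = S
    generalize ∑ k, y k i ^ 2 = q
    have hM : (m : ℝ) * τ ^ 2 + σ ^ 2 ≠ 0 := by positivity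
    field_simp
    ring
  calc _ = (2 * π * τ ^ 2) ^ (-(d : ℝ) / 2) * ((2 * π * σ ^ 2) ^ (-(d : ℝ) / 2)) ^ m *
        Real.exp (-sqDist u x / (2 * τ ^ 2) + ∑ k, -sqDist x (y k) / (2 * σ ^ 2)) := by
        rw [Real.exp_add]
        ring
    _ = _ := by
        rw [hexp, Real.exp_add, Real.exp_add, Real.exp_add]
        ring

lemma integrable_exp_neg_mul_sum_sq {a : ℝ} (ha : 0 < a) :
    Integrable fun x : Fin d → ℝ => Real.exp (-a * ∑ i, x i ^ 2) := by
  simp only [Finset.mul_sum, Real.exp_sum]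
  exact Integrable.fintype_prod (f := fun _ t => Real.exp (-a * t ^ 2))
    fun _ => integrable_exp_neg_mul_sq ha

/-- The joint density of the measurements, with the latent signal integrated out. -/
lemma exists_jointD_eq {μ : Measure (Fin d → ℝ)} [IsFiniteMeasure μ] {R σ τ : ℝ}
    (hσ : 0 < σ) (hτ : 0 < τ) (hμ : ∀ᵐ z ∂μ, ∑ i, z i ^ 2 ≤ R ^ 2) {p : (Fin d → ℝ) → ℝ}
    (hp : ∀ x, p x = ∫ z, gKer d τ z x ∂μ) (m : ℕ) :
    ∃ C : ℝ, 0 < C ∧ ∀ y : Fin m → Fin d → ℝ, jointD p σ m y =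
      C * Real.exp (∑ i, (τ ^ 2 / (2 * σ ^ 2 * (m * τ ^ 2 + σ ^ 2)) * (∑ k, y k i) ^ 2
          - (∑ k, y k i ^ 2) / (2 * σ ^ 2))) *
        expInt μ (1 / (m * τ ^ 2 + σ ^ 2))
          (fun u => Real.exp (-(m : ℝ) / (2 * (m * τ ^ 2 + σ ^ 2)) * ∑ i, u i ^ 2))
          (fun i => ∑ k, y k i) := by
  set M : ℝ := m * τ ^ 2 + σ ^ 2
  have hM : 0 < M := by positivity
  set a : ℝ := M / (2 * σ ^ 2 * τ ^ 2)
  have ha : 0 < a := by positivity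
  have hint := integrable_exp_neg_mul_sum_sq (d := d) ha
  set A : ℝ := (2 * π * τ ^ 2) ^ (-(d : ℝ) / 2) * ((2 * π * σ ^ 2) ^ (-(d : ℝ) / 2)) ^ m
  set K : ℝ := ∫ x : Fin d → ℝ, Real.exp (-a * ∑ i, x i ^ 2)
  have hK : 0 < K := integral_exp_pos hint
  have hA : 0 < A := by positivity
  refine ⟨A * K, mul_pos hA hK, fun y => ?_⟩
  have hform := fun u x => gKer_mul_prod_gKer hσ hτ m u x y
  set E : ℝ := Real.exp (∑ i, (τ ^ 2 / (2 * σ ^ 2 * M) * (∑ k, y k i) ^ 2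
          - (∑ k, y k i ^ 2) / (2 * σ ^ 2)))
  set W : (Fin d → ℝ) → ℝ := fun u => Real.exp (-(m : ℝ) / (2 * M) * ∑ i, u i ^ 2) *
    Real.exp (1 / M * ∑ i, u i * ∑ k, y k i) with hW
  set q : (Fin d → ℝ) → Fin d → ℝ := fun u i => (σ ^ 2 * u i + τ ^ 2 * ∑ k, y k i) / M with hq
  have hform' : ∀ u x, gKer d τ u x * ∏ k, gKer d σ x (y k) =
      A * E * W u * Real.exp (-a * ∑ i, ((x - q u) i) ^ 2) := hform
  have hWc : Continuous W := by fun_prop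
  have hqc : Continuous q := by fun_prop
  have hinner : ∀ u, ∫ x, gKer d τ u x * ∏ k, gKer d σ x (y k) = A * E * K * W u := by
    intro u
    simp only [hform']
    rw [integral_const_mul,
      integral_sub_right_eq_self (fun x : Fin d → ℝ => Real.exp (-a * ∑ i, x i ^ 2)) (q u)]
    ring
  have hcont : Continuous (Function.uncurry fun x u => gKer d τ u x * ∏ k, gKer d σ x (y k)) := by
    simp only [hform']
    fun_prop
  have hnonneg : ∀ u x, 0 ≤ gKer d τ u x * ∏ k, gKer d σ x (y k) := by
    intro u x
    rw [hform']
    positivity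
  have hprod : Integrable (Function.uncurry fun x u => gKer d τ u x * ∏ k, gKer d σ x (y k))
      ((volume : Measure (Fin d → ℝ)).prod μ) := by
    rw [integrable_prod_iff' hcont.aestronglyMeasurable]
    refine ⟨.of_forall fun u => ?_, ?_⟩
    · simp only [Function.uncurry_apply_pair, hform']
      exact (hint.comp_sub_right (q u)).const_mul _
    · simp only [Function.uncurry_apply_pair, Real.norm_of_nonneg (hnonneg _ _), hinner]
      exact integrable_of_continuous_of_ae_sq_le hμ (by fun_prop)
  calc jointD p σ m y = ∫ x, ∫ u, gKer d τ u x * ∏ k, gKer d σ x (y k) ∂μ := by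
        simp only [jointD, hp, integral_mul_const]
    _ = ∫ u, (∫ x, gKer d τ u x * ∏ k, gKer d σ x (y k)) ∂μ :=
        integral_integral_swap hprod
    _ = A * K * E * ∫ u, W u ∂μ := by
        simp only [hinner]
        rw [integral_const_mul]
        ring

end

/-- If `‖Z‖ ≤ R` a.s., `X = Z + N(0, τ²I)` and `Y_k = X + N(0, σ²I)` i.i.d., then for every
number of measurements `m ≥ 1` (here `m = n + 1`) and all `y_{1:m}`,
`∇²_{y_m} log p(y_m | y_{1:m−1}) ≼ ζ(m)·I` with
`ζ(m) = (1/σ²)(τ²/(mτ² + σ²) − 1) + R²/(mτ² + σ²)²`. -/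
theorem stmt12 (d : ℕ) (σ τ R : ℝ) (hσ : 0 < σ) (hτ : 0 < τ) (hR : 0 < R)
    (μZ : Measure (Fin d → ℝ)) [IsProbabilityMeasure μZ]
    (hZbd : ∀ᵐ z ∂μZ, ∑ i, z i ^ 2 ≤ R ^ 2)
    (pX : (Fin d → ℝ) → ℝ)
    (hpX : ∀ x, pX x = ∫ z, gKer d τ z x ∂μZ) :
    ∀ (n : ℕ) (y : Fin (n + 1) → Fin d → ℝ),
      ((((1 / σ ^ 2) * (τ ^ 2 / ((n + 1 : ℝ) * τ ^ 2 + σ ^ 2) - 1)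
          + R ^ 2 / ((n + 1 : ℝ) * τ ^ 2 + σ ^ 2) ^ 2) • (1 : Matrix (Fin d) (Fin d) ℝ))
        - condHess pX σ n y).PosSemidef := by
  intro n y
  obtain ⟨C, hC, hjoint⟩ := exists_jointD_eq hσ hτ hZbd hpX (n + 1)
  obtain ⟨C', hC', hjoint'⟩ := exists_jointD_eq hσ hτ hZbd hpX n
  have hden : 0 < jointD pX σ n fun k => y k.castSucc := by
    rw [hjoint']
    exact mul_pos (mul_pos hC' (Real.exp_pos _))
      (expInt_pos hZbd (by fun_prop) (fun _ => Real.exp_pos _) _ _)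
  push_cast at hjoint
  set D : ℝ := jointD pX σ n fun k => y k.castSucc
  set M : ℝ := (n + 1 : ℝ) * τ ^ 2 + σ ^ 2
  have hM : 0 < M := by positivity
  set S : Fin d → ℝ := fun i => ∑ k : Fin n, y k.castSucc i
  set q : Fin d → ℝ := fun i => ∑ k : Fin n, y k.castSucc i ^ 2
  set w : (Fin d → ℝ) → ℝ := fun u =>
    Real.exp (-(n + 1 : ℝ) / (2 * M) * ∑ i, u i ^ 2) * Real.exp (1 / M * ∑ i, u i * S i)
  have hw : Continuous w := by fun_prop
  have hw0 : ∀ u, 0 < w u := fun u => mul_pos (Real.exp_pos _) (Real.exp_pos _)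
  set α : ℝ := (1 / σ ^ 2) * (τ ^ 2 / M - 1) with hα
  have hlog : (fun z => Real.log (jointD pX σ (n + 1) (Function.update y (Fin.last n) z) / D)) =
      fun z => (Real.log C - Real.log D
          + ∑ i, (τ ^ 2 / (2 * σ ^ 2 * M) * S i ^ 2 - q i / (2 * σ ^ 2)))
        + ∑ i, (α / 2 * z i ^ 2 + (τ ^ 2 / (σ ^ 2 * M) * S i) * z i)
        + Real.log (expInt μZ (1 / M) w z) := by
    funext z
    have hsum : ∀ i, ∑ k, Function.update y (Fin.last n) z k i = S i + z i := by
      intro i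
      simp [Fin.sum_univ_castSucc, S, Fin.castSucc_ne_last]
    have hsum2 : ∀ i, ∑ k, Function.update y (Fin.last n) z k i ^ 2 = q i + z i ^ 2 := by
      intro i
      simp [Fin.sum_univ_castSucc, q, Fin.castSucc_ne_last]
    have hΦ : expInt μZ (1 / M) (fun u => Real.exp (-(n + 1 : ℝ) / (2 * M) * ∑ i, u i ^ 2))
        (fun i => S i + z i) = expInt μZ (1 / M) w z := by
      simp only [expInt, w, mul_add, Finset.sum_add_distrib, Real.exp_add, mul_assoc]
    have hpos := expInt_pos hZbd hw hw0 (1 / M) z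
    rw [hjoint]
    simp only [hsum, hsum2]
    rw [hΦ, Real.log_div (by positivity) hden.ne', Real.log_mul (by positivity) hpos.ne',
      Real.log_mul hC.ne' (Real.exp_pos _).ne', Real.log_exp]
    have hexp : ∑ i, (τ ^ 2 / (2 * σ ^ 2 * M) * (S i + z i) ^ 2
        - (q i + z i ^ 2) / (2 * σ ^ 2)) =
        ∑ i, (τ ^ 2 / (2 * σ ^ 2 * M) * S i ^ 2 - q i / (2 * σ ^ 2)) +
          ∑ i, (α / 2 * z i ^ 2 + (τ ^ 2 / (σ ^ 2 * M) * S i) * z i) := by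
      rw [← Finset.sum_add_distrib]
      refine Finset.sum_congr rfl fun i _ => ?_
      rw [hα]
      field_simp
      ring
    rw [hexp]
    ring
  have hcoef : α + R ^ 2 / M ^ 2 = α + (1 / M) ^ 2 * R ^ 2 := by
    rw [div_pow, one_pow, one_div_mul_eq_div]
  rw [condHess, hlog, hcoef]
  exact posSemidef_sub_hess' hZbd hw hw0 α (1 / M) _ _ _

end
end

section
/- Let Z satisfy ‖Z‖ ≤ R a.s., X = Z + N₀ with N₀ ~ N(0, τ²I), and Y₁ = X + N₁ with N₁ ~ N(0, σ²I), all independent. If σ² > R² − τ², then the density of Y₁ is strongly log-concave: ∇² log p_{Y₁}(y) ≼ −c·I for some c > 0; moreover all subsequent conditional densities p(y_t | y_{1:t−1}) for t ≥ 2 remain strongly log-concave with at least the same constant. -/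
open MeasureTheory Real

noncomputable section

lemma ae_norm_le_of_ae_sum_sq_le {d : ℕ} {μ : Measure (Fin d → ℝ)} {R : ℝ} (hR : 0 ≤ R)
    (hμ : ∀ᵐ z ∂μ, ∑ i, z i ^ 2 ≤ R ^ 2) :
    ∀ᵐ z ∂μ, ‖z‖ ≤ R := by
  filter_upwards [hμ] with z hz
  refine (pi_norm_le_iff_of_nonneg hR).2 fun i => abs_le_of_sq_le_sq ?_ hR
  exact (Finset.single_le_sum (f := fun i => z i ^ 2) (fun i _ => sq_nonneg _)
    (Finset.mem_univ i)).trans hz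

section BoundedSupport

variable {d : ℕ} {μ : Measure (Fin d → ℝ)} [IsFiniteMeasure μ] {R : ℝ}

lemma integrable_of_continuous_of_ae_norm_le (hμ : ∀ᵐ z ∂μ, ‖z‖ ≤ R)
    {E : Type*} [NormedAddCommGroup E] [SecondCountableTopology E]
    {f : (Fin d → ℝ) → E} (hf : Continuous f) : Integrable f μ := by
  obtain ⟨C, hC⟩ := (isCompact_closedBall (0 : Fin d → ℝ) R).exists_bound_of_continuousOn
    hf.continuousOn
  refine Integrable.of_bound hf.aestronglyMeasurable C ?_
  filter_upwards [hμ] with z hz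
  exact hC z (by simpa using hz)

lemma hasFDerivAt_integral_of_ae_norm_le (hμ : ∀ᵐ z ∂μ, ‖z‖ ≤ R)
    {F : (Fin d → ℝ) → (Fin d → ℝ) → ℝ} {F' : (Fin d → ℝ) → (Fin d → ℝ) → (Fin d → ℝ) →L[ℝ] ℝ}
    (hF : ∀ w, Continuous (F w)) (hF' : Continuous (Function.uncurry F'))
    (hd : ∀ w z, HasFDerivAt (fun w => F w z) (F' w z) w) (w : Fin d → ℝ) :
    HasFDerivAt (fun w => ∫ z, F w z ∂μ) (∫ z, F' w z ∂μ) w := by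
  obtain ⟨C, hC⟩ := ((isCompact_closedBall w 1).prod
    (isCompact_closedBall (0 : Fin d → ℝ) R)).exists_bound_of_continuousOn hF'.continuousOn
  refine hasFDerivAt_integral_of_dominated_of_fderiv_le (bound := fun _ => C)
    (Metric.closedBall_mem_nhds w one_pos)
    (Filter.Eventually.of_forall fun w => (hF w).aestronglyMeasurable)
    (integrable_of_continuous_of_ae_norm_le hμ (hF w))
    (hF'.comp (Continuous.prodMk_right w)).aestronglyMeasurable ?_ (integrable_const _)
    (Filter.Eventually.of_forall fun z w _ => hd w z)
  filter_upwards [hμ] with z hz w hw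
  exact hC (w, z) ⟨hw, by simpa using hz⟩

/-- The functional `v ↦ ∑ i, z i * v i`. -/
def dotCLM (z : Fin d → ℝ) : (Fin d → ℝ) →L[ℝ] ℝ :=
  ∑ i, z i • ContinuousLinearMap.proj i

@[simp]
lemma dotCLM_apply (z v : Fin d → ℝ) : dotCLM z v = ∑ i, z i * v i := by
  simp [dotCLM]

lemma continuous_dotCLM : Continuous (dotCLM : (Fin d → ℝ) → _) := by
  unfold dotCLM
  fun_prop

lemma dotCLM_single (z : Fin d → ℝ) (j : Fin d) : dotCLM z (Pi.single j 1) = z j := by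
  simp [Pi.single_apply]

/-- The exponentially tilted integral of `f` against `μ`. -/
def tilt (μ : Measure (Fin d → ℝ)) (β : ℝ) (f : (Fin d → ℝ) → ℝ) (w : Fin d → ℝ) : ℝ :=
  ∫ z, f z * exp (β * dotCLM z w) ∂μ

lemma continuous_tilt_integrand (β : ℝ) {f : (Fin d → ℝ) → ℝ} (hf : Continuous f)
    (w : Fin d → ℝ) : Continuous fun z => f z * exp (β * dotCLM z w) := by
  simp only [dotCLM_apply]
  fun_prop

lemma hasFDerivAt_tilt (hμ : ∀ᵐ z ∂μ, ‖z‖ ≤ R) (β : ℝ) {f : (Fin d → ℝ) → ℝ}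
    (hf : Continuous f) (w : Fin d → ℝ) :
    HasFDerivAt (tilt μ β f) (β • dotCLM fun i => tilt μ β (fun z => f z * z i) w) w := by
  have hcont : Continuous (Function.uncurry fun w z : Fin d → ℝ =>
      (f z * exp (β * dotCLM z w) * β) • dotCLM z) := by
    have := continuous_dotCLM (d := d)
    simp only [dotCLM_apply, Function.uncurry_def]
    fun_prop
  have key := hasFDerivAt_integral_of_ae_norm_le hμ (F := fun w z => f z * exp (β * dotCLM z w))
    (F' := fun w z => (f z * exp (β * dotCLM z w) * β) • dotCLM z)
    (continuous_tilt_integrand β hf) hcont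
    (fun w z => by
      have := (((dotCLM z).hasFDerivAt (x := w)).const_mul β).exp.const_mul (f z)
      refine this.congr_fderiv ?_
      simp only [smul_smul, mul_assoc]) w
  refine key.congr_fderiv ?_
  ext v
  have hint : Integrable (fun z => (f z * exp (β * dotCLM z w) * β) • dotCLM z) μ :=
    integrable_of_continuous_of_ae_norm_le hμ (hcont.comp (Continuous.prodMk_right w))
  rw [ContinuousLinearMap.integral_apply hint]
  simp only [smul_apply, dotCLM_apply (fun i => _), smul_eq_mul, tilt,
    ← integral_mul_const]
  rw [← integral_finsetSum, ← integral_const_mul]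
  · congr 1 with z
    simp only [Finset.mul_sum]
    exact Finset.sum_congr rfl fun i _ => by ring
  · intro i _
    exact integrable_of_continuous_of_ae_norm_le hμ (by fun_prop)

lemma tilt_exp_pos [NeZero μ] (hμ : ∀ᵐ z ∂μ, ‖z‖ ≤ R) (β : ℝ) {φ : (Fin d → ℝ) → ℝ}
    (hφ : Continuous φ) (w : Fin d → ℝ) : 0 < tilt μ β (fun z => exp (φ z)) w := by
  simp only [tilt, ← exp_add]
  refine integral_exp_pos (integrable_of_continuous_of_ae_norm_le hμ ?_)
  simp only [dotCLM_apply]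
  fun_prop

/-- A quadratic function plus the logarithm of an exponentially tilted integral. -/
def quadLogTilt (μ : Measure (Fin d → ℝ)) (K α β : ℝ) (b : Fin d → ℝ) (φ : (Fin d → ℝ) → ℝ)
    (w : Fin d → ℝ) : ℝ :=
  K + (∑ i, (b i * w i - α / 2 * w i ^ 2)) + log (tilt μ β (fun z => exp (φ z)) w)

lemma fderiv_quadLogTilt_single [NeZero μ] (hμ : ∀ᵐ z ∂μ, ‖z‖ ≤ R) (K α β : ℝ)
    (b : Fin d → ℝ) {φ : (Fin d → ℝ) → ℝ} (hφ : Continuous φ) (w : Fin d → ℝ) (j : Fin d) :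
    fderiv ℝ (quadLogTilt μ K α β b φ) w (Pi.single j 1) =
      b j - α * w j + β * (tilt μ β (fun z => exp (φ z) * z j) w *
        (tilt μ β (fun z => exp (φ z)) w)⁻¹) := by
  have hquad : HasFDerivAt (fun w : Fin d → ℝ => ∑ i, (b i * w i - α / 2 * w i ^ 2))
      (dotCLM fun i => b i - α * w i) w := by
    refine (HasFDerivAt.fun_sum fun i _ => ((hasFDerivAt_apply i w).const_mul (b i)).sub
      (((hasFDerivAt_apply i w).pow 2).const_mul (α / 2))).congr_fderiv ?_
    ext v
    simp only [dotCLM_apply, sum_apply, sub_apply, smul_apply, smul_eq_mul,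
      ContinuousLinearMap.proj_apply, nsmul_eq_mul]
    exact Finset.sum_congr rfl fun i _ => by push_cast; ring
  have hlog := (hasFDerivAt_tilt hμ β (f := fun z => exp (φ z)) (by fun_prop) w).log
    (tilt_exp_pos hμ β hφ w).ne'
  have := ((hquad.const_add K).add hlog).fderiv
  unfold quadLogTilt
  erw [this]
  rw [add_apply, smul_apply, smul_apply, dotCLM_single, dotCLM_single]
  simp only [smul_eq_mul]
  ring

lemma hess'_quadLogTilt [NeZero μ] (hμ : ∀ᵐ z ∂μ, ‖z‖ ≤ R) (K α β : ℝ)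
    (b : Fin d → ℝ) {φ : (Fin d → ℝ) → ℝ} (hφ : Continuous φ) (w : Fin d → ℝ) (i j : Fin d) :
    hess' (quadLogTilt μ K α β b φ) w i j =
      -α * (1 : Matrix (Fin d) (Fin d) ℝ) i j + β ^ 2 *
        (tilt μ β (fun z => exp (φ z) * z j * z i) w / tilt μ β (fun z => exp (φ z)) w -
          tilt μ β (fun z => exp (φ z) * z i) w / tilt μ β (fun z => exp (φ z)) w *
          (tilt μ β (fun z => exp (φ z) * z j) w / tilt μ β (fun z => exp (φ z)) w)) := by
  have hpos := tilt_exp_pos hμ β hφ w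
  simp only [hess', Matrix.of_apply, fderiv_quadLogTilt_single hμ K α β b hφ]
  have hden := (hasDerivAt_inv hpos.ne').comp_hasFDerivAt w
    (hasFDerivAt_tilt hμ β (f := fun z => exp (φ z)) (by fun_prop) w)
  have hnum := hasFDerivAt_tilt hμ β (f := fun z => exp (φ z) * z j) (by fun_prop) w
  have hlin := ((hasFDerivAt_apply (𝕜 := ℝ) j w).const_mul α).const_sub (b j)
  have := (hlin.add ((hnum.mul hden).const_mul β)).fderiv
  erw [this]
  simp only [add_apply, smul_apply, neg_apply, dotCLM_single, smul_eq_mul,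
    ContinuousLinearMap.proj_apply, Matrix.one_apply, Pi.single_apply, Function.comp_apply,
    eq_comm (a := i)]
  field_simp
  split_ifs <;> ring

lemma tilt_exp_mul_sq_le (hR : 0 ≤ R) (hμ : ∀ᵐ z ∂μ, ∑ i, z i ^ 2 ≤ R ^ 2) (β : ℝ)
    {φ : (Fin d → ℝ) → ℝ} (hφ : Continuous φ) (w v : Fin d → ℝ) :
    ∑ i, ∑ j, v i * v j * tilt μ β (fun z => exp (φ z) * z j * z i) w ≤
      R ^ 2 * (∑ i, v i ^ 2) * tilt μ β (fun z => exp (φ z)) w := by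
  have hμ' := ae_norm_le_of_ae_sum_sq_le hR hμ
  have hint : ∀ {f : (Fin d → ℝ) → ℝ}, Continuous f → Integrable f μ :=
    fun hf => integrable_of_continuous_of_ae_norm_le hμ' hf
  simp only [tilt, dotCLM_apply, ← integral_const_mul]
  have hswap : ∀ i, ∑ j, ∫ z, v i * v j * (exp (φ z) * z j * z i * exp (β * ∑ k, z k * w k)) ∂μ =
      ∫ z, ∑ j, v i * v j * (exp (φ z) * z j * z i * exp (β * ∑ k, z k * w k)) ∂μ := fun i =>
    (integral_finsetSum _ fun j _ => hint (by fun_prop)).symm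
  simp only [hswap]
  rw [← integral_finsetSum _ fun i _ => hint (by fun_prop)]
  refine integral_mono_ae (hint (by fun_prop)) (hint (by fun_prop)) ?_
  filter_upwards [hμ] with z hz
  have hsq : ∑ i, ∑ j, v i * v j * (exp (φ z) * z j * z i * exp (β * ∑ k, z k * w k)) =
      (∑ i, z i * v i) ^ 2 * (exp (φ z) * exp (β * ∑ k, z k * w k)) := by
    rw [sq, Finset.sum_mul_sum, Finset.sum_mul]
    refine Finset.sum_congr rfl fun i _ => ?_
    rw [Finset.sum_mul]
    exact Finset.sum_congr rfl fun j _ => by ring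
  rw [hsq]
  gcongr
  exact (Finset.sum_mul_sq_le_sq_mul_sq _ _ _).trans (by gcongr)

theorem posSemidef_sub_hess'_quadLogTilt [NeZero μ] (hR : 0 ≤ R)
    (hμ : ∀ᵐ z ∂μ, ∑ i, z i ^ 2 ≤ R ^ 2) (K α β c : ℝ) (hc : c + β ^ 2 * R ^ 2 ≤ α)
    (b : Fin d → ℝ) {φ : (Fin d → ℝ) → ℝ} (hφ : Continuous φ) (w : Fin d → ℝ) :
    ((-c) • (1 : Matrix (Fin d) (Fin d) ℝ) - hess' (quadLogTilt μ K α β b φ) w).PosSemidef := by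
  have hμ' := ae_norm_le_of_ae_sum_sq_le hR hμ
  have hentry := hess'_quadLogTilt hμ' K α β b hφ w
  have hpos := tilt_exp_pos hμ' β hφ w
  refine Matrix.PosSemidef.of_dotProduct_mulVec_nonneg ?_ fun v => ?_
  · ext i j
    simp only [Matrix.conjTranspose_apply, Matrix.sub_apply, Matrix.smul_apply, hentry,
      star_trivial, smul_eq_mul, Matrix.one_apply, eq_comm (a := i), mul_right_comm _ (_ : ℝ)]
    ring
  · have hle := tilt_exp_mul_sq_le hR hμ β hφ w v
    set T := tilt μ β (fun z => exp (φ z)) w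
    set P : Fin d → Fin d → ℝ := fun i j => tilt μ β (fun z => exp (φ z) * z j * z i) w with hP
    set m : Fin d → ℝ := fun i => tilt μ β (fun z => exp (φ z) * z i) w / T with hm
    have hquad : star v ⬝ᵥ ((-c) • (1 : Matrix (Fin d) (Fin d) ℝ) -
        hess' (quadLogTilt μ K α β b φ) w).mulVec v =
        (α - c) * ∑ i, v i ^ 2 - β ^ 2 * ((∑ i, ∑ j, v i * v j * P i j) / T)
          + β ^ 2 * (∑ i, v i * m i) ^ 2 := by
      have hdiag : ∑ i, v i ^ 2 =
          ∑ i, ∑ j, v i * v j * (1 : Matrix (Fin d) (Fin d) ℝ) i j := by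
        simp [Matrix.one_apply, sq]
      rw [hdiag, sq (∑ i, v i * m i), Finset.sum_mul_sum]
      simp only [dotProduct, Matrix.mulVec, Matrix.sub_apply, Matrix.smul_apply, hentry,
        star_trivial, smul_eq_mul, Finset.mul_sum, Finset.sum_div, ← Finset.sum_sub_distrib,
        ← Finset.sum_add_distrib]
      refine Finset.sum_congr rfl fun i _ => Finset.sum_congr rfl fun j _ => ?_
      simp only [hP, hm]
      ring
    have hdiv : (∑ i, ∑ j, v i * v j * P i j) / T ≤ R ^ 2 * ∑ i, v i ^ 2 :=
      (div_le_iff₀ hpos).2 hle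
    have hv : 0 ≤ ∑ i, v i ^ 2 := Finset.sum_nonneg fun i _ => sq_nonneg _
    rw [hquad]
    nlinarith [mul_le_mul_of_nonneg_left hdiv (sq_nonneg β), mul_le_mul_of_nonneg_right hc hv,
      mul_nonneg (sq_nonneg β) (sq_nonneg (∑ i, v i * m i))]

end BoundedSupport

lemma integrable_exp_neg_mul_sqDist {d : ℕ} {a : ℝ} (ha : 0 < a) (m : Fin d → ℝ) :
    Integrable fun x : Fin d → ℝ => exp (-a * sqDist x m) := by
  have h : Integrable (fun x : Fin d → ℝ => ∏ i, exp (-a * x i ^ 2)) :=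
    Integrable.fintype_prod fun _ => integrable_exp_neg_mul_sq ha
  refine (h.comp_sub_right m).congr (Filter.Eventually.of_forall fun x => ?_)
  simp only [sqDist, ← exp_sum, ← Finset.mul_sum, Pi.sub_apply]

lemma integral_exp_neg_mul_sqDist {d : ℕ} (a : ℝ) (m : Fin d → ℝ) :
    ∫ x : Fin d → ℝ, exp (-a * sqDist x m) = ∫ x : Fin d → ℝ, exp (-a * sqDist x 0) := by
  rw [← integral_sub_right_eq_self (fun x : Fin d → ℝ => exp (-a * sqDist x 0)) m]
  simp [sqDist]

/-- Gaussian marginalization against a compactly supported mixing measure. -/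
lemma integral_integral_exp_neg_mul_sqDist {d : ℕ} {μ : Measure (Fin d → ℝ)} [IsFiniteMeasure μ]
    {R : ℝ} (hμ : ∀ᵐ z ∂μ, ‖z‖ ≤ R) {a : ℝ} (ha : 0 < a) {W : (Fin d → ℝ) → ℝ}
    (hW : Continuous W) {m : (Fin d → ℝ) → Fin d → ℝ} (hm : Continuous m) :
    ∫ x, ∫ z, exp (W z) * exp (-a * sqDist x (m z)) ∂μ =
      (∫ x : Fin d → ℝ, exp (-a * sqDist x 0)) * ∫ z, exp (W z) ∂μ := by
  have hint : Integrable (Function.uncurry fun z x : Fin d → ℝ =>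
      exp (W z) * exp (-a * sqDist x (m z))) (μ.prod volume) := by
    have hcont : Continuous (Function.uncurry fun z x : Fin d → ℝ =>
        exp (W z) * exp (-a * sqDist x (m z))) := by
      simp only [Function.uncurry_def, sqDist]
      fun_prop
    refine (integrable_prod_iff hcont.aestronglyMeasurable).2
      ⟨Filter.Eventually.of_forall fun z =>
        (integrable_exp_neg_mul_sqDist ha (m z)).const_mul (exp (W z)), ?_⟩
    simp only [Function.uncurry_apply_pair, norm_mul, norm_eq_abs, abs_exp, integral_const_mul,
      integral_exp_neg_mul_sqDist a (m _)]
    exact integrable_of_continuous_of_ae_norm_le hμ (by fun_prop)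
  rw [← integral_integral_swap hint]
  simp only [integral_const_mul, integral_exp_neg_mul_sqDist a (m _), integral_mul_const]
  ring

/-- The exponent left after integrating the signal `x` out of the joint Gaussian weight of
`z`, `x` and the observations `y`. -/
def marginalExponent {d : ℕ} (σ τ : ℝ) (n : ℕ) (y : Fin n → Fin d → ℝ) (z : Fin d → ℝ) : ℝ :=
  ∑ i, (-z i ^ 2 / (2 * τ ^ 2) - (∑ k, y k i ^ 2) / (2 * σ ^ 2) +
    (σ ^ 2 * z i + τ ^ 2 * ∑ k, y k i) ^ 2 / (2 * (σ ^ 2 + n * τ ^ 2) * σ ^ 2 * τ ^ 2))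

lemma exponent_eq_marginalExponent {d : ℕ} {σ τ : ℝ} (hσ : 0 < σ) (hτ : 0 < τ) (n : ℕ)
    (y : Fin n → Fin d → ℝ) (z x : Fin d → ℝ) :
    -sqDist z x / (2 * τ ^ 2) + ∑ k, -sqDist x (y k) / (2 * σ ^ 2) =
      marginalExponent σ τ n y z + -((σ ^ 2 + n * τ ^ 2) / (2 * σ ^ 2 * τ ^ 2)) *
        sqDist x (fun i => (σ ^ 2 * z i + τ ^ 2 * ∑ k, y k i) / (σ ^ 2 + n * τ ^ 2)) := by
  have hD : 0 < σ ^ 2 + n * τ ^ 2 := by positivity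
  simp only [sqDist, marginalExponent]
  rw [← Finset.sum_div, Finset.sum_neg_distrib, Finset.sum_comm, ← Finset.sum_neg_distrib,
    ← Finset.sum_neg_distrib, Finset.sum_div, Finset.sum_div, ← Finset.sum_add_distrib,
    Finset.mul_sum, ← Finset.sum_add_distrib]
  refine Finset.sum_congr rfl fun i _ => ?_
  have hsq : ∑ k, (x i - y k i) ^ 2 = n * x i ^ 2 - 2 * x i * ∑ k, y k i + ∑ k, y k i ^ 2 := by
    simp only [sub_sq, Finset.sum_add_distrib, Finset.sum_sub_distrib, Finset.mul_sum]
    simp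
  rw [hsq]
  field_simp
  ring

lemma exists_jointD_eq_mul_integral {d : ℕ} {σ τ R : ℝ} (hσ : 0 < σ) (hτ : 0 < τ)
    {μ : Measure (Fin d → ℝ)} [IsFiniteMeasure μ] (hμ : ∀ᵐ z ∂μ, ‖z‖ ≤ R)
    {p : (Fin d → ℝ) → ℝ} (hp : ∀ x, p x = ∫ z, gKer d τ z x ∂μ) (n : ℕ) :
    ∃ C : ℝ, 0 < C ∧ ∀ y : Fin n → Fin d → ℝ,
      jointD p σ n y = C * ∫ z, exp (marginalExponent σ τ n y z) ∂μ := by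
  set a : ℝ := (σ ^ 2 + n * τ ^ 2) / (2 * σ ^ 2 * τ ^ 2) with ha
  have hapos : 0 < a := by positivity
  refine ⟨(2 * π * τ ^ 2) ^ (-(d : ℝ) / 2) * ((2 * π * σ ^ 2) ^ (-(d : ℝ) / 2)) ^ n *
    ∫ x : Fin d → ℝ, exp (-a * sqDist x 0), ?_, fun y => ?_⟩
  · have := integral_exp_pos (integrable_exp_neg_mul_sqDist hapos (0 : Fin d → ℝ))
    positivity
  · rw [mul_assoc, ← integral_integral_exp_neg_mul_sqDist hμ hapos
      (W := marginalExponent σ τ n y) (by unfold marginalExponent; fun_prop)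
      (m := fun z i => (σ ^ 2 * z i + τ ^ 2 * ∑ k, y k i) / (σ ^ 2 + n * τ ^ 2)) (by fun_prop),
      ← integral_const_mul]
    unfold jointD
    congr 1 with x
    rw [hp, ← integral_mul_const, ← integral_const_mul]
    congr 1 with z
    rw [← exp_add, ha, ← exponent_eq_marginalExponent hσ hτ n y z x, exp_add, exp_sum]
    simp only [gKer, Finset.prod_mul_distrib, Finset.prod_const, Finset.card_univ,
      Fintype.card_fin]
    ring

lemma marginalExponent_update_last {d : ℕ} {σ τ : ℝ} (hσ : 0 < σ) (hτ : 0 < τ) (n : ℕ)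
    (y : Fin (n + 1) → Fin d → ℝ) (w z : Fin d → ℝ) :
    marginalExponent σ τ (n + 1) (Function.update y (Fin.last n) w) z =
      marginalExponent σ τ (n + 1) (Function.update y (Fin.last n) 0) z +
      (∑ i, (τ ^ 2 * (∑ k : Fin n, y k.castSucc i) / ((σ ^ 2 + (n + 1) * τ ^ 2) * σ ^ 2) * w i -
        (1 / σ ^ 2 - τ ^ 2 / ((σ ^ 2 + (n + 1) * τ ^ 2) * σ ^ 2)) / 2 * w i ^ 2)) +
      (σ ^ 2 + (n + 1) * τ ^ 2)⁻¹ * dotCLM z w := by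
  have hD : 0 < σ ^ 2 + (n + 1) * τ ^ 2 := by positivity
  have hupd : ∀ v (k : Fin n), Function.update y (Fin.last n) v k.castSucc = y k.castSucc :=
    fun v k => Function.update_of_ne (Fin.castSucc_lt_last k).ne _ _
  simp only [marginalExponent, Fin.sum_univ_castSucc, Function.update_self, hupd, dotCLM_apply,
    Pi.zero_apply]
  rw [Finset.mul_sum, ← Finset.sum_add_distrib, ← Finset.sum_add_distrib]
  refine Finset.sum_congr rfl fun i _ => ?_
  push_cast
  field_simp
  ring

theorem exists_log_jointD_div_eq_quadLogTilt {d : ℕ} {σ τ R : ℝ} (hσ : 0 < σ) (hτ : 0 < τ)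
    {μ : Measure (Fin d → ℝ)} [IsFiniteMeasure μ] [NeZero μ] (hμ : ∀ᵐ z ∂μ, ‖z‖ ≤ R)
    {p : (Fin d → ℝ) → ℝ} (hp : ∀ x, p x = ∫ z, gKer d τ z x ∂μ) (n : ℕ)
    (y : Fin (n + 1) → Fin d → ℝ) :
    ∃ (K : ℝ) (b : Fin d → ℝ) (φ : (Fin d → ℝ) → ℝ), Continuous φ ∧
      (fun w => log (jointD p σ (n + 1) (Function.update y (Fin.last n) w) /
        jointD p σ n fun k => y k.castSucc)) =
      quadLogTilt μ K (1 / σ ^ 2 - τ ^ 2 / ((σ ^ 2 + (n + 1) * τ ^ 2) * σ ^ 2))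
        (σ ^ 2 + (n + 1) * τ ^ 2)⁻¹ b φ := by
  obtain ⟨C, hC, hnum⟩ := exists_jointD_eq_mul_integral hσ hτ hμ hp (n + 1)
  obtain ⟨C', hC', hden⟩ := exists_jointD_eq_mul_integral hσ hτ hμ hp n
  have hcont : ∀ (m : ℕ) (y : Fin m → Fin d → ℝ), Continuous (marginalExponent σ τ m y) :=
    fun m y => by unfold marginalExponent; fun_prop
  have hJ : 0 < jointD p σ n fun k => y k.castSucc := by
    rw [hden]
    exact mul_pos hC' (integral_exp_pos (integrable_of_continuous_of_ae_norm_le hμ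
      (continuous_exp.comp (hcont _ _))))
  set φ := marginalExponent σ τ (n + 1) (Function.update y (Fin.last n) 0) with hφ
  refine ⟨log C - log (jointD p σ n fun k => y k.castSucc),
    fun i => τ ^ 2 * (∑ k : Fin n, y k.castSucc i) / ((σ ^ 2 + (n + 1) * τ ^ 2) * σ ^ 2),
    φ, hcont _ _, ?_⟩
  funext w
  have hT := tilt_exp_pos hμ (σ ^ 2 + (n + 1) * τ ^ 2)⁻¹ (hcont (n + 1) _ : Continuous φ) w
  have hjoint : ∀ q : ℝ, ∫ z, exp (φ z + q + (σ ^ 2 + (n + 1) * τ ^ 2)⁻¹ * dotCLM z w) ∂μ =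
      exp q * tilt μ (σ ^ 2 + (n + 1) * τ ^ 2)⁻¹ (fun z => exp (φ z)) w := fun q => by
    rw [tilt, ← integral_const_mul]
    congr 1 with z
    rw [exp_add, exp_add]
    ring
  simp only [hnum, marginalExponent_update_last hσ hτ n y w, ← hφ, hjoint]
  rw [log_div (by positivity) hJ.ne', log_mul hC.ne' (by positivity),
    log_mul (exp_ne_zero _) hT.ne', log_exp, quadLogTilt]
  ring

lemma curvature_bound {σ τ R : ℝ} (hσ : 0 < σ) (hτ : 0 < τ) (n : ℕ) :
    (σ ^ 2 + τ ^ 2 - R ^ 2) / (σ ^ 2 + τ ^ 2) ^ 2 + (σ ^ 2 + (n + 1) * τ ^ 2)⁻¹ ^ 2 * R ^ 2 ≤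
      1 / σ ^ 2 - τ ^ 2 / ((σ ^ 2 + (n + 1) * τ ^ 2) * σ ^ 2) := by
  have hn : (0 : ℝ) ≤ n * τ ^ 2 := by positivity
  have hsD : σ ^ 2 + τ ^ 2 ≤ σ ^ 2 + (n + 1) * τ ^ 2 := by linarith
  have hvar : (σ ^ 2 + (n + 1) * τ ^ 2)⁻¹ ^ 2 * R ^ 2 ≤ R ^ 2 / (σ ^ 2 + τ ^ 2) ^ 2 := by
    rw [inv_pow, inv_mul_eq_div]
    gcongr
  have hmain : 1 / (σ ^ 2 + τ ^ 2) ≤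
      1 / σ ^ 2 - τ ^ 2 / ((σ ^ 2 + (n + 1) * τ ^ 2) * σ ^ 2) := by
    have hD : 0 < σ ^ 2 + (n + 1) * τ ^ 2 := by positivity
    have hrhs : 1 / σ ^ 2 - τ ^ 2 / ((σ ^ 2 + (n + 1) * τ ^ 2) * σ ^ 2) =
        (σ ^ 2 + n * τ ^ 2) / ((σ ^ 2 + (n + 1) * τ ^ 2) * σ ^ 2) := by
      field_simp
      ring
    rw [hrhs, div_le_div_iff₀ (by positivity) (by positivity)]
    nlinarith [mul_nonneg hn (sq_nonneg τ)]
  have hsplit : (σ ^ 2 + τ ^ 2 - R ^ 2) / (σ ^ 2 + τ ^ 2) ^ 2 =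
      1 / (σ ^ 2 + τ ^ 2) - R ^ 2 / (σ ^ 2 + τ ^ 2) ^ 2 := by
    field_simp
  linarith

/-- Once log-concave, always log-concave: if `‖Z‖ ≤ R` a.s., `X = Z + N(0, τ²I)`,
`Y_t = X + N(0, σ²I)` i.i.d., and `σ² > R² − τ²`, then there is `c > 0` such that
`∇² log p(y₁) ≼ −c·I` and all subsequent conditional densities `p(y_t | y_{1:t−1})`
satisfy the same strong log-concavity bound. -/
theorem stmt14 (d : ℕ) (σ τ R : ℝ) (hσ : 0 < σ) (hτ : 0 < τ) (hR : 0 < R)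
    (hlc : σ ^ 2 > R ^ 2 - τ ^ 2)
    (μZ : Measure (Fin d → ℝ)) [IsProbabilityMeasure μZ]
    (hZbd : ∀ᵐ z ∂μZ, ∑ i, z i ^ 2 ≤ R ^ 2)
    (pX : (Fin d → ℝ) → ℝ)
    (hpX : ∀ x, pX x = ∫ z, gKer d τ z x ∂μZ) :
    ∃ c : ℝ, 0 < c ∧
      ∀ (n : ℕ) (y : Fin (n + 1) → Fin d → ℝ),
        ((-c) • (1 : Matrix (Fin d) (Fin d) ℝ) - condHess pX σ n y).PosSemidef := by
  have hpos : 0 < σ ^ 2 + τ ^ 2 - R ^ 2 := by linarith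
  refine ⟨(σ ^ 2 + τ ^ 2 - R ^ 2) / (σ ^ 2 + τ ^ 2) ^ 2, by positivity, fun n y => ?_⟩
  obtain ⟨K, b, φ, hφ, heq⟩ := exists_log_jointD_div_eq_quadLogTilt hσ hτ
    (ae_norm_le_of_ae_sum_sq_le hR.le hZbd) hpX n y
  rw [condHess, heq]
  exact posSemidef_sub_hess'_quadLogTilt hR.le hZbd K _ _ _ (curvature_bound hσ hτ n) b hφ _

end
end

section
/- Suppose f : ℝ^d → ℝ is C² with ∇²f(x) ≼ L·I for all x and ‖∇f(x)‖ ≥ μ‖x − x₀‖ − Δ for some x₀ ∈ ℝ^d, μ > 0, Δ ≥ 0. Let p_Y be the density of Y = X + N, X ~ e^{−f}/Z, N ~ N(0, σ²I). Then for all y: ∇² log p_Y(y) ≼ (−1 + 3Ld/(μ²σ²) + 3Δ²/(μ²σ²) + 3‖x₀ − y‖²/(μ²σ⁶))·(I/σ²). In particular p_Y is locally strongly log-concave at y whenever 3Ld/μ² + 3Δ²/μ² + 3‖x₀−y‖²/(μ²σ⁴) < σ². -/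
open MeasureTheory Real

noncomputable section

def grad' {d : ℕ} (g : (Fin d → ℝ) → ℝ) (y : Fin d → ℝ) (i : Fin d) : ℝ :=
  fderiv ℝ g y (Pi.single i 1)

open Filter Topology

section CutoffIntegration

variable {d : ℕ} {h χ : (Fin d → ℝ) → ℝ}

lemma contDiff_grad' (hh : ContDiff ℝ 2 h) (i : Fin d) : ContDiff ℝ 1 fun x => grad' h x i :=
  (hh.fderiv_right (m := 1) (by norm_num)).clm_apply contDiff_const

lemma hess'_eq_fderiv_grad' (h : (Fin d → ℝ) → ℝ) (x : Fin d → ℝ) (i j : Fin d) :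
    hess' h x i j = fderiv ℝ (fun z => grad' h z j) x (Pi.single i 1) := rfl

lemma continuous_hess' (hh : ContDiff ℝ 2 h) (i j : Fin d) : Continuous fun x => hess' h x i j := by
  simp only [hess'_eq_fderiv_grad']
  exact ((contDiff_grad' hh j).continuous_fderiv one_ne_zero).clm_apply continuous_const

lemma integral_mul_grad'_sq_mul_exp_neg (hh : ContDiff ℝ 2 h) (hχ : ContDiff ℝ 1 χ)
    (hc : HasCompactSupport χ) (i : Fin d) :
    ∫ x, χ x * grad' h x i ^ 2 * exp (-h x)
      = ∫ x, (grad' χ x i * grad' h x i + χ x * hess' h x i i) * exp (-h x) := by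
  have hg := contDiff_grad' hh i
  have hexp : ContDiff ℝ 2 fun x => exp (-h x) := hh.neg.exp
  have hprod : ContDiff ℝ 1 fun x => χ x * grad' h x i := hχ.mul hg
  have hpc : HasCompactSupport fun x => χ x * grad' h x i := hc.mul_right
  have hd_exp (x : Fin d → ℝ) :
      fderiv ℝ (fun x => exp (-h x)) x (Pi.single i 1) = -(grad' h x i * exp (-h x)) := by
    have : fderiv ℝ (fun x => exp (-h x)) x = exp (-h x) • -fderiv ℝ h x :=
      ((hh.differentiable (by norm_num) x).hasFDerivAt.neg.exp).fderiv
    rw [this]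
    simp [grad', mul_comm]
  have hd_prod (x : Fin d → ℝ) : fderiv ℝ (fun x => χ x * grad' h x i) x (Pi.single i 1)
      = grad' χ x i * grad' h x i + χ x * hess' h x i i := by
    have : fderiv ℝ (fun x => χ x * grad' h x i) x
        = χ x • fderiv ℝ (fun x => grad' h x i) x + grad' h x i • fderiv ℝ χ x :=
      ((hχ.differentiable one_ne_zero x).hasFDerivAt.mul
        (hg.differentiable one_ne_zero x).hasFDerivAt).fderiv
    rw [this, hess'_eq_fderiv_grad']
    simp [grad']
    ring
  have key := integral_mul_fderiv_eq_neg_fderiv_mul_of_integrable (μ := (volume : Measure (Fin d → ℝ)))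
    (f := fun x => χ x * grad' h x i) (g := fun x => exp (-h x)) (v := Pi.single i 1)
    (Continuous.integrable_of_hasCompactSupport
      (((hprod.continuous_fderiv one_ne_zero).clm_apply continuous_const).mul hexp.continuous)
      (hpc.fderiv_apply ℝ (Pi.single i 1)).mul_right)
    (Continuous.integrable_of_hasCompactSupport
      (hprod.continuous.mul ((hexp.continuous_fderiv (by norm_num)).clm_apply continuous_const))
      hpc.mul_right)
    (Continuous.integrable_of_hasCompactSupport (hprod.continuous.mul hexp.continuous)
      hpc.mul_right)
    (fun x _ => hprod.differentiable one_ne_zero x)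
    (fun x _ => hexp.differentiable (by norm_num) x)
  simp only [hd_exp, hd_prod] at key
  rw [← neg_inj, ← key, ← integral_neg]
  congr 1 with x
  ring

lemma integral_cutoff_mul_le (hh : ContDiff ℝ 2 h) (hi : Integrable fun x => exp (-h x)) {T : ℝ}
    (hT : ∀ x, ∑ i, hess' h x i i ≤ T) {u : (Fin d → ℝ) → ℝ} (hu : Continuous u)
    (hu_le : ∀ x, u x ≤ ∑ i, grad' h x i ^ 2) (hχ : ContDiff ℝ 1 χ) (hc : HasCompactSupport χ)
    {B : ℝ} (hB : ∀ x i, |grad' χ x i| ≤ B) {δ : ℝ} (hδ : 0 < δ) (hδ1 : δ ≤ 1) :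
    (1 - δ) * ∫ x, χ x ^ 2 * (u x * exp (-h x))
      ≤ T * (∫ x, χ x ^ 2 * exp (-h x)) + d * B ^ 2 / δ * ∫ x, exp (-h x) := by
  have hχc : Continuous χ := hχ.continuous
  have hhc : Continuous h := hh.continuous
  have hgc (i : Fin d) : Continuous fun x => grad' h x i := (contDiff_grad' hh i).continuous
  have hHc (i : Fin d) : Continuous fun x => hess' h x i i := continuous_hess' hh i i
  have hgχ (i : Fin d) : Continuous fun x => grad' χ x i :=
    (hχ.continuous_fderiv one_ne_zero).clm_apply continuous_const
  have hχ2 : HasCompactSupport fun x => χ x ^ 2 := by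
    simp only [sq]
    exact hc.mul_right
  have hcross (i : Fin d) : Integrable fun x =>
      (2 * χ x * grad' χ x i * grad' h x i + χ x ^ 2 * hess' h x i i) * exp (-h x) := by
    have : HasCompactSupport fun x =>
        2 * χ x * grad' χ x i * grad' h x i + χ x ^ 2 * hess' h x i i := by
      have hfactor (x : Fin d → ℝ) : 2 * χ x * grad' χ x i * grad' h x i + χ x ^ 2 * hess' h x i i
          = χ x * (2 * grad' χ x i * grad' h x i + χ x * hess' h x i i) := by ring
      simp only [hfactor]
      exact hc.mul_right
    exact Continuous.integrable_of_hasCompactSupport (by fun_prop) this.mul_right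
  have hint {k : (Fin d → ℝ) → ℝ} (hk : Continuous k) :
      Integrable fun x => χ x ^ 2 * (k x * exp (-h x)) :=
    Continuous.integrable_of_hasCompactSupport (by fun_prop)
      hχ2.mul_right
  have hgrad_sq (x : Fin d → ℝ) (i : Fin d) :
      grad' (fun x => χ x ^ 2) x i = 2 * χ x * grad' χ x i := by
    have := ((hχ.differentiable one_ne_zero x).hasFDerivAt.pow 2).fderiv
    simp only [grad', this]
    simp
  have hparts : ∫ x, χ x ^ 2 * ((∑ i, grad' h x i ^ 2) * exp (-h x))
      = ∫ x, ∑ i, (2 * χ x * grad' χ x i * grad' h x i + χ x ^ 2 * hess' h x i i)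
        * exp (-h x) := by
    rw [integral_finsetSum _ fun i _ => hcross i]
    simp only [Finset.sum_mul, Finset.mul_sum]
    rw [integral_finsetSum _ fun i _ => hint (k := fun x => grad' h x i ^ 2) ((hgc i).pow 2)]
    refine Finset.sum_congr rfl fun i _ => ?_
    have := integral_mul_grad'_sq_mul_exp_neg hh (hχ.pow 2) hχ2 i
    simp only [hgrad_sq] at this
    simpa only [mul_assoc] using this
  have h1 := hint (k := fun x => ∑ i, grad' h x i ^ 2) (by fun_prop)
  have h2 : Integrable fun x => χ x ^ 2 * exp (-h x) := by
    simpa only [one_mul] using hint (k := fun _ => 1) continuous_const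
  have h3 : Integrable fun x => δ * (χ x ^ 2 * ((∑ i, grad' h x i ^ 2) * exp (-h x)))
      + T * (χ x ^ 2 * exp (-h x)) := (h1.const_mul δ).add (h2.const_mul T)
  have hyoung : ∫ x, χ x ^ 2 * ((∑ i, grad' h x i ^ 2) * exp (-h x))
      ≤ ∫ x, (δ * (χ x ^ 2 * ((∑ i, grad' h x i ^ 2) * exp (-h x)))
        + T * (χ x ^ 2 * exp (-h x)) + d * B ^ 2 / δ * exp (-h x)) := by
    rw [hparts]
    refine integral_mono (integrable_finsetSum _ fun i _ => hcross i)
      (h3.add (hi.const_mul _)) fun x => ?_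
    have hterm (i : Fin d) : 2 * χ x * grad' χ x i * grad' h x i
        ≤ δ * (χ x ^ 2 * grad' h x i ^ 2) + B ^ 2 / δ := by
      have hB2 : grad' χ x i ^ 2 ≤ B ^ 2 := sq_le_sq' (abs_le.1 (hB x i)).1 (abs_le.1 (hB x i)).2
      have : 2 * χ x * grad' χ x i * grad' h x i
          ≤ δ * (χ x ^ 2 * grad' h x i ^ 2) + grad' χ x i ^ 2 / δ := by
        have hsq : 0 ≤ (δ * (χ x * grad' h x i) - grad' χ x i) ^ 2 / δ := by positivity
        have heq : (δ * (χ x * grad' h x i) - grad' χ x i) ^ 2 / δ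
            = δ * (χ x ^ 2 * grad' h x i ^ 2) + grad' χ x i ^ 2 / δ
              - 2 * χ x * grad' χ x i * grad' h x i := by
          field_simp
          ring
        linarith
      have : grad' χ x i ^ 2 / δ ≤ B ^ 2 / δ := by gcongr
      linarith
    have hsum := Finset.sum_le_sum fun i (_ : i ∈ Finset.univ) => hterm i
    simp only [Finset.sum_add_distrib, ← Finset.mul_sum, Finset.sum_const, Finset.card_univ,
      Fintype.card_fin, nsmul_eq_mul] at hsum
    have hTx := mul_le_mul_of_nonneg_left (hT x) (sq_nonneg (χ x))
    dsimp only
    rw [← Finset.sum_mul, Finset.sum_add_distrib, ← Finset.mul_sum]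
    have : (d : ℝ) * B ^ 2 / δ = d * (B ^ 2 / δ) := by ring
    have hfin : (∑ i, 2 * χ x * grad' χ x i * grad' h x i) + χ x ^ 2 * ∑ i, hess' h x i i
        ≤ δ * (χ x ^ 2 * ∑ i, grad' h x i ^ 2) + T * χ x ^ 2 + d * B ^ 2 / δ := by
      linarith
    have := mul_le_mul_of_nonneg_right hfin (exp_pos (-h x)).le
    linarith
  rw [integral_add h3 (hi.const_mul _),
    integral_add (h1.const_mul δ) (h2.const_mul T), integral_const_mul, integral_const_mul,
    integral_const_mul] at hyoung
  have hmono : ∫ x, χ x ^ 2 * (u x * exp (-h x))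
      ≤ ∫ x, χ x ^ 2 * ((∑ i, grad' h x i ^ 2) * exp (-h x)) :=
    integral_mono (hint hu) h1 fun x => by
      dsimp only
      gcongr
      exact hu_le x
  have := mul_le_mul_of_nonneg_left hmono (sub_nonneg.2 hδ1)
  linarith

/-- If `u ≤ ‖∇h‖²` and `Δh ≤ T`, then the mean of `u` under the density `∝ e^{-h}` is at
most `T`. -/
lemma integral_mul_exp_neg_le (hh : ContDiff ℝ 2 h) (hi : Integrable fun x => exp (-h x)) {T : ℝ}
    (hT : ∀ x, ∑ i, hess' h x i i ≤ T) {u : (Fin d → ℝ) → ℝ} (hu : Continuous u)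
    (hui : Integrable fun x => u x * exp (-h x)) (hu_le : ∀ x, u x ≤ ∑ i, grad' h x i ^ 2) :
    ∫ x, u x * exp (-h x) ≤ T * ∫ x, exp (-h x) := by
  let ψ : ContDiffBump (0 : Fin d → ℝ) := ⟨1, 2, one_pos, one_lt_two⟩
  have hψ : ContDiff ℝ 1 ψ := ψ.contDiff
  obtain ⟨B, hB⟩ := (hψ.continuous_fderiv one_ne_zero).bounded_above_of_compact_support
    (ψ.hasCompactSupport.fderiv ℝ)
  let r : ℕ → ℝ := fun n => 1 / ((n : ℝ) + 1)
  have hr0 (n : ℕ) : 0 < r n := Nat.one_div_pos_of_nat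
  have hr1 (n : ℕ) : r n ≤ 1 := by
    simpa [r] using inv_le_one_of_one_le₀ (by linarith [n.cast_nonneg (α := ℝ)] : (1 : ℝ) ≤ n + 1)
  have hr : Tendsto r atTop (𝓝 0) := tendsto_one_div_add_atTop_nhds_zero_nat
  let χ : ℕ → (Fin d → ℝ) → ℝ := fun n x => ψ (r n • x)
  have hχ (n : ℕ) : ContDiff ℝ 1 (χ n) := hψ.comp (contDiff_const_smul (r n))
  have hχB (n : ℕ) (x : Fin d → ℝ) (i : Fin d) : |grad' (χ n) x i| ≤ r n * B := by
    have h1 : fderiv ℝ (χ n) x = r n • fderiv ℝ ψ (r n • x) := fderiv_comp_smul _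
    have h2 : |fderiv ℝ ψ (r n • x) (Pi.single i 1)| ≤ B := by
      refine ((fderiv ℝ ψ (r n • x)).le_opNorm _).trans ?_
      have h3 : ‖(Pi.single i 1 : Fin d → ℝ)‖ = 1 := by rw [Pi.norm_single, norm_one]
      rw [h3, mul_one]
      exact hB (r n • x)
    rw [grad', h1, smul_apply, smul_eq_mul, abs_mul, abs_of_pos (hr0 n)]
    exact mul_le_mul_of_nonneg_left h2 (hr0 n).le
  have hbound (n : ℕ) := integral_cutoff_mul_le hh hi hT hu hu_le (hχ n)
    (ψ.hasCompactSupport.comp_smul (hr0 n).ne') (hχB n) (hr0 n) (hr1 n)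
  have hlim {k : (Fin d → ℝ) → ℝ} (hk : Integrable k) :
      Tendsto (fun n => ∫ x, χ n x ^ 2 * k x) atTop (𝓝 (∫ x, k x)) := by
    refine tendsto_integral_of_dominated_convergence (fun x => ‖k x‖)
      (fun n => (((hχ n).continuous.pow 2).aestronglyMeasurable.mul hk.1)) hk.norm
      (fun n => ae_of_all _ fun x => ?_) (ae_of_all _ fun x => ?_)
    · rw [norm_mul, norm_pow]
      refine mul_le_of_le_one_left (norm_nonneg _) (pow_le_one₀ (norm_nonneg _) ?_)
      rw [Real.norm_of_nonneg ψ.nonneg]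
      exact ψ.le_one
    · have h0 : Tendsto (fun n => χ n x) atTop (𝓝 (ψ ((0 : ℝ) • x))) :=
        (hψ.continuous.tendsto _).comp (hr.smul_const x)
      have h1 : ψ ((0 : ℝ) • x) = 1 :=
        ψ.one_of_mem_closedBall (by simp [ψ])
      rw [h1] at h0
      simpa using (h0.pow 2).mul_const (k x)
  have herr (n : ℕ) : (d : ℝ) * (r n * B) ^ 2 / r n = r n * (d * B ^ 2) := by
    field_simp [(hr0 n).ne']
  simp only [herr] at hbound
  have hL := ((tendsto_const_nhds (x := (1 : ℝ))).sub hr).mul (hlim hui)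
  have hR := ((hlim hi).const_mul T).add ((hr.mul_const ((d : ℝ) * B ^ 2)).mul_const
    (∫ x, exp (-h x)))
  simpa using le_of_tendsto_of_tendsto' hL hR hbound

end CutoffIntegration

/-- The function `f` with a quadratic confinement of strength `ε` at `x₀` and a linear tilt by `b`. -/
def tiltPotential {d : ℕ} (f : (Fin d → ℝ) → ℝ) (x₀ : Fin d → ℝ) (ε : ℝ) (b x : Fin d → ℝ) : ℝ :=
  f x + ε / 2 * sqDist x x₀ - ∑ i, b i * (x i - x₀ i)

/-- The unnormalised mean of `k` under the density `∝ e^{-tiltPotential f x₀ ε b}`. -/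
def tiltIntegral {d : ℕ} (f : (Fin d → ℝ) → ℝ) (x₀ : Fin d → ℝ) (ε : ℝ) (k : (Fin d → ℝ) → ℝ)
    (b : Fin d → ℝ) : ℝ :=
  ∫ x, k x * exp (-tiltPotential f x₀ ε b x)

/-- The `i`-th coordinate as a continuous linear functional. -/
def coordProj {d : ℕ} (i : Fin d) : (Fin d → ℝ) →L[ℝ] ℝ := ContinuousLinearMap.proj i

section Tilt

variable {d : ℕ} {f : (Fin d → ℝ) → ℝ} {x₀ : Fin d → ℝ} {ε : ℝ}

@[simp]
lemma coordProj_apply (i : Fin d) (v : Fin d → ℝ) : coordProj i v = v i := rfl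

lemma hasFDerivAt_coord (i : Fin d) (x : Fin d → ℝ) :
    HasFDerivAt (fun x : Fin d → ℝ => x i) (coordProj i) x :=
  (coordProj i).hasFDerivAt

lemma sqDist_nonneg (x y : Fin d → ℝ) : 0 ≤ sqDist x y :=
  Finset.sum_nonneg fun _ _ => sq_nonneg _

lemma sqDist_comm (x y : Fin d → ℝ) : sqDist x y = sqDist y x :=
  Finset.sum_congr rfl fun _ _ => by ring

lemma contDiff_sqDist {n : WithTop ℕ∞} (x₀ : Fin d → ℝ) : ContDiff ℝ n fun x => sqDist x x₀ := by
  unfold sqDist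
  fun_prop

lemma continuous_sqDist (x₀ : Fin d → ℝ) : Continuous fun x => sqDist x x₀ :=
  (contDiff_sqDist (n := 0) x₀).continuous

lemma abs_coord_mul_coord_le (x x₀ : Fin d → ℝ) (i j : Fin d) :
    |(x i - x₀ i) * (x j - x₀ j)| ≤ sqDist x x₀ := by
  have hle (i : Fin d) : (x i - x₀ i) ^ 2 ≤ sqDist x x₀ :=
    Finset.single_le_sum (f := fun i => (x i - x₀ i) ^ 2) (fun _ _ => sq_nonneg _)
      (Finset.mem_univ i)
  rw [abs_le]
  constructor <;>
    nlinarith [hle i, hle j, sq_nonneg (x i - x₀ i - (x j - x₀ j)),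
      sq_nonneg (x i - x₀ i + (x j - x₀ j))]

lemma abs_coord_le (x x₀ : Fin d → ℝ) (i : Fin d) : |x i - x₀ i| ≤ 1 + sqDist x x₀ := by
  have h := abs_coord_mul_coord_le x x₀ i i
  rw [abs_mul] at h
  nlinarith [sq_nonneg (|x i - x₀ i| - 1)]

lemma contDiff_tiltPotential (hf : ContDiff ℝ 2 f) (x₀ : Fin d → ℝ) (ε : ℝ) (b : Fin d → ℝ) :
    ContDiff ℝ 2 (tiltPotential f x₀ ε b) := by
  unfold tiltPotential
  have := contDiff_sqDist (n := 2) x₀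
  fun_prop

lemma grad'_sqDist (x₀ x : Fin d → ℝ) (i : Fin d) :
    grad' (fun x => sqDist x x₀) x i = 2 * (x i - x₀ i) := by
  have h (j : Fin d) : HasFDerivAt (fun x : Fin d → ℝ => (x j - x₀ j) ^ 2)
      ((2 * (x j - x₀ j)) • coordProj j) x := by
    simpa using ((hasFDerivAt_coord j x).sub_const (x₀ j)).pow 2
  have hs : HasFDerivAt (fun x => sqDist x x₀)
      (∑ j, (2 * (x j - x₀ j)) • coordProj j) x :=
    HasFDerivAt.fun_sum fun j _ => h j
  rw [grad', hs.fderiv]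
  simp [Pi.single_apply]

lemma grad'_linear (b x₀ x : Fin d → ℝ) (i : Fin d) :
    grad' (fun x => ∑ j, b j * (x j - x₀ j)) x i = b i := by
  have hs : HasFDerivAt (fun x : Fin d → ℝ => ∑ j, b j * (x j - x₀ j))
      (∑ j, b j • coordProj j) x :=
    HasFDerivAt.fun_sum fun j _ =>
      ((hasFDerivAt_coord j x).sub_const (x₀ j)).const_mul (b j)
  rw [grad', hs.fderiv]
  simp [Pi.single_apply]

lemma grad'_tiltPotential (hf : ContDiff ℝ 2 f) (b x : Fin d → ℝ) (i : Fin d) :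
    grad' (tiltPotential f x₀ ε b) x i = grad' f x i + ε * (x i - x₀ i) - b i := by
  have h1 : DifferentiableAt ℝ f x := hf.differentiable (by norm_num) x
  have h2 : DifferentiableAt ℝ (fun x => sqDist x x₀) x :=
    (contDiff_sqDist (n := 1) x₀).differentiable one_ne_zero x
  have h3 : DifferentiableAt ℝ (fun x : Fin d → ℝ => ∑ j, b j * (x j - x₀ j)) x := by fun_prop
  have h : fderiv ℝ (tiltPotential f x₀ ε b) x = fderiv ℝ f x
      + (ε / 2) • fderiv ℝ (fun x => sqDist x x₀) x
      - fderiv ℝ (fun x : Fin d → ℝ => ∑ j, b j * (x j - x₀ j)) x :=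
    ((h1.hasFDerivAt.add (h2.hasFDerivAt.const_mul (ε / 2))).sub h3.hasFDerivAt).fderiv
  have hq := grad'_sqDist x₀ x i
  have hl := grad'_linear b x₀ x i
  simp only [grad'] at hq hl ⊢
  simp only [h, sub_apply, add_apply, smul_apply, smul_eq_mul, hq, hl]
  ring

lemma hess'_tiltPotential (hf : ContDiff ℝ 2 f) (b x : Fin d → ℝ) (i : Fin d) :
    hess' (tiltPotential f x₀ ε b) x i i = hess' f x i i + ε := by
  have h1 : DifferentiableAt ℝ (fun x => grad' f x i) x :=
    (contDiff_grad' hf i).differentiable one_ne_zero x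
  have h : fderiv ℝ (fun x => grad' f x i + ε * (x i - x₀ i) - b i) x
      = fderiv ℝ (fun x => grad' f x i) x
        + ε • coordProj i :=
    ((h1.hasFDerivAt.add (((hasFDerivAt_coord i x).sub_const (x₀ i)).const_mul ε)).sub_const
      (b i)).fderiv
  simp only [hess'_eq_fderiv_grad', grad'_tiltPotential hf, h]
  simp

lemma exp_neg_tiltPotential_le (hε : 0 < ε) {B : ℝ} {b : Fin d → ℝ} (hb : ∑ i, b i ^ 2 ≤ B)
    (x : Fin d → ℝ) :
    (1 + sqDist x x₀) * exp (-tiltPotential f x₀ ε b x)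
      ≤ (1 + 4 / ε) * exp (B / ε) * exp (-f x) := by
  have hlin : ∑ i, b i * (x i - x₀ i) ≤ ε / 4 * sqDist x x₀ + B / ε := by
    have hterm (i : Fin d) : b i * (x i - x₀ i) ≤ ε / 4 * (x i - x₀ i) ^ 2 + b i ^ 2 / ε := by
      have hsq : 0 ≤ (ε / 2 * (x i - x₀ i) - b i) ^ 2 / ε := by positivity
      have heq : (ε / 2 * (x i - x₀ i) - b i) ^ 2 / ε
          = ε / 4 * (x i - x₀ i) ^ 2 + b i ^ 2 / ε - b i * (x i - x₀ i) := by
        field_simp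
        ring
      linarith
    have hsum := Finset.sum_le_sum fun i (_ : i ∈ Finset.univ) => hterm i
    rw [Finset.sum_add_distrib, ← Finset.mul_sum, ← Finset.sum_div] at hsum
    have : (∑ i, b i ^ 2) / ε ≤ B / ε := by gcongr
    exact hsum.trans (by unfold sqDist; linarith)
  have hpoly : 1 + sqDist x x₀ ≤ (1 + 4 / ε) * exp (ε / 4 * sqDist x x₀) := by
    have hq := sqDist_nonneg x x₀
    have h1 := add_one_le_exp (ε / 4 * sqDist x x₀)
    have h2 : (1 + 4 / ε) * (ε / 4 * sqDist x x₀ + 1)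
        = 1 + sqDist x x₀ + (ε / 4 * sqDist x x₀ + 4 / ε) := by
      field_simp
      ring
    have h3 : (1 + 4 / ε) * (ε / 4 * sqDist x x₀ + 1)
        ≤ (1 + 4 / ε) * exp (ε / 4 * sqDist x x₀) := by gcongr
    have h4 : 0 ≤ ε / 4 * sqDist x x₀ + 4 / ε := by positivity
    linarith
  calc (1 + sqDist x x₀) * exp (-tiltPotential f x₀ ε b x)
      ≤ (1 + 4 / ε) * exp (ε / 4 * sqDist x x₀) * exp (-tiltPotential f x₀ ε b x) := by gcongr
    _ = (1 + 4 / ε) * exp (ε / 4 * sqDist x x₀ - tiltPotential f x₀ ε b x) := by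
        rw [mul_assoc, ← exp_add, sub_eq_add_neg]
    _ ≤ (1 + 4 / ε) * exp (B / ε + -f x) := by
        gcongr
        unfold tiltPotential
        linarith
    _ = _ := by rw [exp_add, mul_assoc]

lemma continuous_tiltPotential (hf : Continuous f) (b : Fin d → ℝ) :
    Continuous (tiltPotential f x₀ ε b) := by
  unfold tiltPotential
  have := continuous_sqDist x₀
  fun_prop

lemma integrable_mul_exp_neg_tiltPotential (hf : Continuous f)
    (hfi : Integrable fun x => exp (-f x)) (hε : 0 < ε) (b : Fin d → ℝ) {k : (Fin d → ℝ) → ℝ}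
    (hk : Continuous k) (hk_le : ∀ x, |k x| ≤ 1 + sqDist x x₀) :
    Integrable fun x => k x * exp (-tiltPotential f x₀ ε b x) := by
  have hc := continuous_tiltPotential (x₀ := x₀) (ε := ε) hf b
  refine (hfi.const_mul ((1 + 4 / ε) * exp ((∑ i, b i ^ 2) / ε))).mono'
    (by fun_prop : Continuous _).aestronglyMeasurable (ae_of_all _ fun x => ?_)
  rw [norm_mul, Real.norm_eq_abs, Real.norm_of_nonneg (exp_pos _).le]
  exact (mul_le_mul_of_nonneg_right (hk_le x) (exp_pos _).le).trans
    (exp_neg_tiltPotential_le hε le_rfl x)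

lemma hasFDerivAt_tiltIntegral (hf : Continuous f) (hfi : Integrable fun x => exp (-f x))
    (hε : 0 < ε) {k : (Fin d → ℝ) → ℝ} (hk : Continuous k) (hk_le : ∀ x, |k x| ≤ 1 + sqDist x x₀)
    (hk_mul : ∀ x i, |k x * (x i - x₀ i)| ≤ 1 + sqDist x x₀) (b : Fin d → ℝ) :
    HasFDerivAt (tiltIntegral f x₀ ε k)
      (∑ i, tiltIntegral f x₀ ε (fun x => k x * (x i - x₀ i)) b •
        coordProj i) b := by
  let F' : (Fin d → ℝ) → (Fin d → ℝ) → ((Fin d → ℝ) →L[ℝ] ℝ) := fun b x =>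
    ∑ i, (k x * (x i - x₀ i) * exp (-tiltPotential f x₀ ε b x)) •
      coordProj i
  have hc (b : Fin d → ℝ) := continuous_tiltPotential (x₀ := x₀) (ε := ε) hf b
  have hnhds : {c : Fin d → ℝ | ∑ i, c i ^ 2 < ∑ i, b i ^ 2 + 1} ∈ 𝓝 b :=
    (isOpen_lt (by fun_prop) continuous_const).mem_nhds (by simp)
  have hi (i : Fin d) := integrable_mul_exp_neg_tiltPotential hf hfi hε b
    (k := fun x => k x * (x i - x₀ i)) (by fun_prop) fun x => hk_mul x i
  have key : HasFDerivAt (tiltIntegral f x₀ ε k) (∫ x, F' b x) b := by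
    refine hasFDerivAt_integral_of_dominated_of_fderiv_le (F' := F')
      (bound := fun x => d * ((1 + 4 / ε) * exp ((∑ i, b i ^ 2 + 1) / ε) * exp (-f x)))
      hnhds (Eventually.of_forall fun c => ?_)
      (integrable_mul_exp_neg_tiltPotential hf hfi hε b hk hk_le) ?_
      (ae_of_all _ fun x c hcmem => ?_) ((hfi.const_mul _).const_mul _)
      (ae_of_all _ fun x c _ => ?_)
    · exact (hk.mul (hc c).neg.rexp).aestronglyMeasurable
    · have := hc b
      exact (by fun_prop : Continuous (F' b)).aestronglyMeasurable
    · have hproj (i : Fin d) :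
          ‖coordProj i‖ ≤ 1 :=
        ContinuousLinearMap.opNorm_le_bound _ zero_le_one fun v => by
          simpa using norm_le_pi_norm v i
      refine (norm_sum_le _ _).trans ?_
      calc ∑ i, ‖(k x * (x i - x₀ i) * exp (-tiltPotential f x₀ ε c x)) •
            coordProj i‖
          ≤ ∑ _i : Fin d, (1 + 4 / ε) * exp ((∑ i, b i ^ 2 + 1) / ε) * exp (-f x) := by
            refine Finset.sum_le_sum fun i _ => ?_
            rw [norm_smul, norm_mul, Real.norm_eq_abs, Real.norm_of_nonneg (exp_pos _).le]
            calc _ ≤ |k x * (x i - x₀ i)| * exp (-tiltPotential f x₀ ε c x) :=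
                  mul_le_of_le_one_right (by positivity) (hproj i)
              _ ≤ (1 + sqDist x x₀) * exp (-tiltPotential f x₀ ε c x) := by
                  gcongr
                  exact hk_mul x i
              _ ≤ _ := exp_neg_tiltPotential_le hε (le_of_lt hcmem) x
        _ = _ := by simp
    · have hpot : HasFDerivAt (fun c => -tiltPotential f x₀ ε c x)
          (∑ i, (x i - x₀ i) • coordProj i) c := by
        have hlin : HasFDerivAt (fun c : Fin d → ℝ => ∑ i, c i * (x i - x₀ i))
            (∑ i, (x i - x₀ i) • coordProj i) c :=
          HasFDerivAt.fun_sum fun i _ => (hasFDerivAt_coord i c).mul_const (x i - x₀ i)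
        have := (hlin.const_sub (f x + ε / 2 * sqDist x x₀)).neg
        rwa [neg_neg] at this
      have heq : F' c x = k x • exp (-tiltPotential f x₀ ε c x) •
          ∑ i, (x i - x₀ i) • (coordProj i : (Fin d → ℝ) →L[ℝ] ℝ) := by
        simp only [F', Finset.smul_sum, smul_smul]
        refine Finset.sum_congr rfl fun i _ => ?_
        congr 1
        ring
      rw [heq]
      exact hpot.exp.const_mul (k x)
  have heq : ∫ x, F' b x
      = ∑ i, tiltIntegral f x₀ ε (fun x => k x * (x i - x₀ i)) b • coordProj i := by
    simp only [F']
    rw [integral_finsetSum _ fun i _ => (hi i).smul_const _]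
    refine Finset.sum_congr rfl fun i _ => ?_
    rw [integral_smul_const]
    rfl
  exact heq ▸ key

lemma tiltIntegral_one_pos (hf : Continuous f) (hfi : Integrable fun x => exp (-f x)) (hε : 0 < ε)
    (b : Fin d → ℝ) : 0 < tiltIntegral f x₀ ε (fun _ => 1) b := by
  have hi := integrable_mul_exp_neg_tiltPotential (x₀ := x₀) hf hfi hε b
    (k := fun _ => 1) continuous_const fun x => by simpa using sqDist_nonneg x x₀
  simp only [one_mul] at hi
  simpa only [tiltIntegral, one_mul] using integral_exp_pos hi

/-- The mean of `‖x - x₀‖²` decreases as the confinement at `x₀` gets stronger. -/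
lemma tiltIntegral_sqDist_anti (hf : Continuous f) (hfi : Integrable fun x => exp (-f x))
    (hε : 0 < ε) {s : ℝ} (hs : ε ≤ s) (b : Fin d → ℝ) :
    tiltIntegral f x₀ s (fun x => sqDist x x₀) b
      ≤ tiltIntegral f x₀ ε (fun x => sqDist x x₀) b / tiltIntegral f x₀ ε (fun _ => 1) b
        * tiltIntegral f x₀ s (fun _ => 1) b := by
  have hs0 : 0 < s := hε.trans_le hs
  have hZ := tiltIntegral_one_pos (x₀ := x₀) hf hfi hε b
  set m := tiltIntegral f x₀ ε (fun x => sqDist x x₀) b / tiltIntegral f x₀ ε (fun _ => 1) b with hm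
  have hi1 {η : ℝ} (hη : 0 < η) := integrable_mul_exp_neg_tiltPotential (x₀ := x₀) hf hfi hη b
    (k := fun _ => 1) continuous_const fun x => by simpa using sqDist_nonneg x x₀
  have hiq {η : ℝ} (hη : 0 < η) := integrable_mul_exp_neg_tiltPotential (x₀ := x₀) hf hfi hη b
    (k := fun x => sqDist x x₀) (continuous_sqDist x₀) fun x => by
      rw [abs_of_nonneg (sqDist_nonneg x x₀)]
      linarith
  have hcentered {η : ℝ} (hη : 0 < η) :
      ∫ x, (sqDist x x₀ * exp (-tiltPotential f x₀ η b x)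
          - m * (1 * exp (-tiltPotential f x₀ η b x)))
        = tiltIntegral f x₀ η (fun x => sqDist x x₀) b - m * tiltIntegral f x₀ η (fun _ => 1) b := by
    rw [integral_sub (hiq hη) ((hi1 hη).const_mul m), integral_const_mul]
    rfl
  have hmono : ∫ x, (sqDist x x₀ * exp (-tiltPotential f x₀ s b x)
        - m * (1 * exp (-tiltPotential f x₀ s b x)))
      ≤ ∫ x, exp (-((s - ε) / 2 * m)) * (sqDist x x₀ * exp (-tiltPotential f x₀ ε b x)
        - m * (1 * exp (-tiltPotential f x₀ ε b x))) := by
    refine integral_mono ((hiq hs0).sub ((hi1 hs0).const_mul m))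
      (((hiq hε).sub ((hi1 hε).const_mul m)).const_mul _) fun x => ?_
    have hsplit : exp (-tiltPotential f x₀ s b x)
        = exp (-((s - ε) / 2 * sqDist x x₀)) * exp (-tiltPotential f x₀ ε b x) := by
      rw [← exp_add]
      unfold tiltPotential
      congr 1
      ring
    have hcheb : (sqDist x x₀ - m) * exp (-((s - ε) / 2 * sqDist x x₀))
        ≤ (sqDist x x₀ - m) * exp (-((s - ε) / 2 * m)) := by
      have hc : 0 ≤ (s - ε) / 2 := by linarith
      rcases le_total m (sqDist x x₀) with hle | hle
      · refine mul_le_mul_of_nonneg_left ?_ (by linarith)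
        gcongr
      · refine mul_le_mul_of_nonpos_left ?_ (by linarith)
        gcongr
    have := mul_le_mul_of_nonneg_right hcheb (exp_pos (-tiltPotential f x₀ ε b x)).le
    dsimp only
    rw [hsplit]
    linarith
  rw [integral_const_mul, hcentered hs0, hcentered hε, hm, div_mul_cancel₀ _ hZ.ne', sub_self,
    mul_zero] at hmono
  linarith

end Tilt

section SmoothedDensity

variable {d : ℕ} {f : (Fin d → ℝ) → ℝ} {x₀ : Fin d → ℝ}

lemma sqrt_sum_sq_eq_norm (v : Fin d → ℝ) : √(∑ i, v i ^ 2) = ‖WithLp.toLp 2 v‖ := by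
  simp [EuclideanSpace.norm_eq]

lemma tiltIntegral_sqDist_le {L Δ μ ε : ℝ} (hf : ContDiff ℝ 2 f)
    (hfi : Integrable fun x => exp (-f x))
    (hhess : ∀ x i, hess' f x i i ≤ L)
    (hgrow : ∀ x, √(∑ i, grad' f x i ^ 2) ≥ μ * √(sqDist x x₀) - Δ)
    (hε : 0 < ε) (hεμ : ε ≤ μ) (b : Fin d → ℝ) :
    (μ - ε) ^ 2 * tiltIntegral f x₀ ε (fun x => sqDist x x₀) b
      ≤ 3 * ((L + ε) * d + Δ ^ 2 + ∑ i, b i ^ 2) * tiltIntegral f x₀ ε (fun _ => 1) b := by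
  have hi1 := integrable_mul_exp_neg_tiltPotential (x₀ := x₀) hf.continuous hfi hε b
    (k := fun _ => 1) continuous_const fun x => by simpa using sqDist_nonneg x x₀
  have hiq := integrable_mul_exp_neg_tiltPotential (x₀ := x₀) hf.continuous hfi hε b
    (k := fun x => sqDist x x₀) (continuous_sqDist x₀) fun x => by
      rw [abs_of_nonneg (sqDist_nonneg x x₀)]
      linarith
  have hlow (x : Fin d → ℝ) : (μ - ε) ^ 2 / 3 * sqDist x x₀ - (Δ ^ 2 + ∑ i, b i ^ 2)
      ≤ ∑ i, grad' (tiltPotential f x₀ ε b) x i ^ 2 := by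
    set g := grad' (tiltPotential f x₀ ε b) x with hg
    have hdecomp : WithLp.toLp 2 (grad' f x)
        = WithLp.toLp 2 g - ε • WithLp.toLp 2 (fun i => x i - x₀ i) + WithLp.toLp 2 b := by
      ext i
      simp [hg, grad'_tiltPotential hf]
      ring
    have htri : √(∑ i, grad' f x i ^ 2)
        ≤ √(∑ i, g i ^ 2) + ε * √(sqDist x x₀) + √(∑ i, b i ^ 2) := by
      rw [sqDist, sqrt_sum_sq_eq_norm, sqrt_sum_sq_eq_norm g, sqrt_sum_sq_eq_norm b,
        sqrt_sum_sq_eq_norm (fun i => x i - x₀ i), hdecomp]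
      refine (norm_add_le _ _).trans ?_
      gcongr
      refine (norm_sub_le _ _).trans_eq ?_
      rw [norm_smul, Real.norm_of_nonneg hε.le]
    have hlin : (μ - ε) * √(sqDist x x₀) ≤ √(∑ i, g i ^ 2) + Δ + √(∑ i, b i ^ 2) := by
      linarith [hgrow x]
    have hsq := pow_le_pow_left₀ (mul_nonneg (sub_nonneg.2 hεμ) (sqrt_nonneg _)) hlin 2
    rw [mul_pow, sq_sqrt (sqDist_nonneg x x₀)] at hsq
    have h1 : √(∑ i, g i ^ 2) ^ 2 = ∑ i, g i ^ 2 :=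
      sq_sqrt (Finset.sum_nonneg fun _ _ => sq_nonneg _)
    have h2 : √(∑ i, b i ^ 2) ^ 2 = ∑ i, b i ^ 2 :=
      sq_sqrt (Finset.sum_nonneg fun _ _ => sq_nonneg _)
    rw [← h1, ← h2]
    nlinarith [sq_nonneg (√(∑ i, g i ^ 2) - Δ), sq_nonneg (√(∑ i, g i ^ 2) - √(∑ i, b i ^ 2)),
      sq_nonneg (Δ - √(∑ i, b i ^ 2))]
  have htrace (x : Fin d → ℝ) : ∑ i, hess' (tiltPotential f x₀ ε b) x i i ≤ (L + ε) * d := by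
    have := Finset.sum_le_sum fun i (_ : i ∈ Finset.univ) => add_le_add_left (hhess x i) ε
    simpa [hess'_tiltPotential hf, mul_comm, add_mul] using this
  have hcomb (x : Fin d → ℝ) : ((μ - ε) ^ 2 / 3 * sqDist x x₀ - (Δ ^ 2 + ∑ i, b i ^ 2))
      * exp (-tiltPotential f x₀ ε b x)
      = (μ - ε) ^ 2 / 3 * (sqDist x x₀ * exp (-tiltPotential f x₀ ε b x))
        - (Δ ^ 2 + ∑ i, b i ^ 2) * (1 * exp (-tiltPotential f x₀ ε b x)) := by ring
  have hcont := continuous_sqDist x₀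
  have key := integral_mul_exp_neg_le (contDiff_tiltPotential hf x₀ ε b)
    (by simpa only [one_mul] using hi1) htrace
    (u := fun x => (μ - ε) ^ 2 / 3 * sqDist x x₀ - (Δ ^ 2 + ∑ i, b i ^ 2)) (by fun_prop)
    (by
      simp only [hcomb]
      exact (hiq.const_mul _).sub (hi1.const_mul _)) hlow
  simp only [hcomb] at key
  rw [integral_sub (hiq.const_mul _) (hi1.const_mul _), integral_const_mul,
    integral_const_mul] at key
  have h1 : tiltIntegral f x₀ ε (fun _ => 1) b = ∫ x, exp (-tiltPotential f x₀ ε b x) := by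
    simp only [tiltIntegral, one_mul]
  simp only [one_mul, ← h1] at key
  change (μ - ε) ^ 2 / 3 * tiltIntegral f x₀ ε (fun x => sqDist x x₀) b - _ ≤ _ at key
  linarith

lemma mean_sqDist_le {L Δ μ s : ℝ} (hf : ContDiff ℝ 2 f)
    (hfi : Integrable fun x => exp (-f x)) (hμ : 0 < μ) (hs : 0 < s)
    (hhess : ∀ x i, hess' f x i i ≤ L)
    (hgrow : ∀ x, √(∑ i, grad' f x i ^ 2) ≥ μ * √(sqDist x x₀) - Δ) (b : Fin d → ℝ) :
    tiltIntegral f x₀ s (fun x => sqDist x x₀) b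
      ≤ 3 * (L * d + Δ ^ 2 + ∑ i, b i ^ 2) / μ ^ 2 * tiltIntegral f x₀ s (fun _ => 1) b := by
  have hZ := tiltIntegral_one_pos (x₀ := x₀) hf.continuous hfi hs b
  have hbound : ∀ᶠ ε in 𝓝[>] (0 : ℝ), (μ - ε) ^ 2 * tiltIntegral f x₀ s (fun x => sqDist x x₀) b
      ≤ 3 * ((L + ε) * d + Δ ^ 2 + ∑ i, b i ^ 2) * tiltIntegral f x₀ s (fun _ => 1) b := by
    filter_upwards [Ioc_mem_nhdsGT (lt_min hμ hs)] with ε hε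
    have hZε := tiltIntegral_one_pos (x₀ := x₀) hf.continuous hfi hε.1 b
    have h1 := tiltIntegral_sqDist_le hf hfi hhess hgrow hε.1 (hε.2.trans (min_le_left _ _)) b
    have h2 := tiltIntegral_sqDist_anti (x₀ := x₀) hf.continuous hfi hε.1
      (hε.2.trans (min_le_right _ _)) b
    calc _ ≤ (μ - ε) ^ 2 * (tiltIntegral f x₀ ε (fun x => sqDist x x₀) b
          / tiltIntegral f x₀ ε (fun _ => 1) b * tiltIntegral f x₀ s (fun _ => 1) b) := by gcongr
      _ = (μ - ε) ^ 2 * tiltIntegral f x₀ ε (fun x => sqDist x x₀) b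
          / tiltIntegral f x₀ ε (fun _ => 1) b * tiltIntegral f x₀ s (fun _ => 1) b := by ring
      _ ≤ _ := by
        gcongr
        exact (div_le_iff₀ hZε).2 h1
  have hL : Tendsto (fun ε => (μ - ε) ^ 2 * tiltIntegral f x₀ s (fun x => sqDist x x₀) b)
      (𝓝[>] 0) (𝓝 ((μ - 0) ^ 2 * tiltIntegral f x₀ s (fun x => sqDist x x₀) b)) :=
    ((by fun_prop : Continuous fun ε : ℝ => (μ - ε) ^ 2
      * tiltIntegral f x₀ s (fun x => sqDist x x₀) b).tendsto 0).mono_left nhdsWithin_le_nhds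
  have hR : Tendsto (fun ε => 3 * ((L + ε) * d + Δ ^ 2 + ∑ i, b i ^ 2)
        * tiltIntegral f x₀ s (fun _ => 1) b)
      (𝓝[>] 0) (𝓝 (3 * ((L + 0) * d + Δ ^ 2 + ∑ i, b i ^ 2)
        * tiltIntegral f x₀ s (fun _ => 1) b)) :=
    ((by fun_prop : Continuous fun ε : ℝ => 3 * ((L + ε) * d + Δ ^ 2 + ∑ i, b i ^ 2)
      * tiltIntegral f x₀ s (fun _ => 1) b).tendsto 0).mono_left nhdsWithin_le_nhds
  have hlim := le_of_tendsto_of_tendsto hL hR hbound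
  rw [sub_zero, add_zero] at hlim
  rw [div_mul_eq_mul_div, le_div_iff₀ (by positivity)]
  linarith

lemma smoothed_eq {σ : ℝ} (hσ : σ ≠ 0) (f : (Fin d → ℝ) → ℝ) (x₀ z : Fin d → ℝ) :
    ∫ x, exp (-f x) * gKer d σ x z
      = (2 * π * σ ^ 2) ^ (-(d : ℝ) / 2) * exp (-((σ ^ 2)⁻¹ / 2 * sqDist z x₀))
        * tiltIntegral f x₀ (σ ^ 2)⁻¹ (fun _ => 1) ((σ ^ 2)⁻¹ • (z - x₀)) := by
  rw [tiltIntegral, ← integral_const_mul]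
  congr 1 with x
  have hexp : exp (-f x) * exp (-sqDist x z / (2 * σ ^ 2))
      = exp (-((σ ^ 2)⁻¹ / 2 * sqDist z x₀))
        * exp (-tiltPotential f x₀ (σ ^ 2)⁻¹ ((σ ^ 2)⁻¹ • (z - x₀)) x) := by
    have hquad : sqDist x z
        = sqDist x x₀ + sqDist z x₀ - 2 * ∑ i, (z i - x₀ i) * (x i - x₀ i) := by
      simp only [sqDist, Finset.mul_sum, ← Finset.sum_add_distrib, ← Finset.sum_sub_distrib]
      exact Finset.sum_congr rfl fun i _ => by ring
    have hlin : ∑ i, ((σ ^ 2)⁻¹ • (z - x₀)) i * (x i - x₀ i)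
        = (σ ^ 2)⁻¹ * ∑ i, (z i - x₀ i) * (x i - x₀ i) := by
      simp only [Pi.smul_apply, Pi.sub_apply, smul_eq_mul, Finset.mul_sum, mul_assoc]
    rw [← exp_add, ← exp_add, tiltPotential, hlin, hquad]
    congr 1
    field_simp
    ring
  rw [gKer, one_mul, mul_left_comm, hexp, ← mul_assoc]

lemma hasFDerivAt_tiltIntegral_comp {s : ℝ} (hf : Continuous f)
    (hfi : Integrable fun x => exp (-f x))
    (hs : 0 < s) {k : (Fin d → ℝ) → ℝ} (hk : Continuous k) (hk_le : ∀ x, |k x| ≤ 1 + sqDist x x₀)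
    (hk_mul : ∀ x i, |k x * (x i - x₀ i)| ≤ 1 + sqDist x x₀) (z : Fin d → ℝ) :
    HasFDerivAt (fun z => tiltIntegral f x₀ s k (s • (z - x₀)))
      (∑ i, (s * tiltIntegral f x₀ s (fun x => k x * (x i - x₀ i)) (s • (z - x₀))) •
        (coordProj i : (Fin d → ℝ) →L[ℝ] ℝ)) z := by
  have h1 := hasFDerivAt_tiltIntegral hf hfi hs hk hk_le hk_mul (s • (z - x₀))
  have h2 : HasFDerivAt (fun z : Fin d → ℝ => s • (z - x₀))
      (s • ContinuousLinearMap.id ℝ (Fin d → ℝ)) z := ((hasFDerivAt_id z).sub_const x₀).const_smul s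
  have heq : (∑ i, (s * tiltIntegral f x₀ s (fun x => k x * (x i - x₀ i)) (s • (z - x₀))) •
        (coordProj i : (Fin d → ℝ) →L[ℝ] ℝ))
      = (∑ i, tiltIntegral f x₀ s (fun x => k x * (x i - x₀ i)) (s • (z - x₀)) • coordProj i).comp
        (s • ContinuousLinearMap.id ℝ (Fin d → ℝ)) := by
    ext v
    simp [mul_assoc, Finset.mul_sum]
  rw [heq]
  exact h1.comp z h2

/-- The Hessian of the log-density of `X + N(0, σ²I)` is `-σ⁻² I + σ⁻⁴ cov(X | y)`. -/
lemma hess'_log_smoothed {σ : ℝ} (hσ : 0 < σ) (hf : Continuous f)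
    (hfi : Integrable fun x => exp (-f x)) (x₀ y : Fin d → ℝ) (i j : Fin d) :
    let E := fun k => tiltIntegral f x₀ (σ ^ 2)⁻¹ k ((σ ^ 2)⁻¹ • (y - x₀))
    hess' (fun z => Real.log (∫ x, exp (-f x) * gKer d σ x z)) y i j
      = -(σ ^ 2)⁻¹ * (1 : Matrix (Fin d) (Fin d) ℝ) i j
        + ((σ ^ 2)⁻¹) ^ 2 * (E (fun x => (x j - x₀ j) * (x i - x₀ i)) / E (fun _ => 1)
          - E (fun x => x j - x₀ j) * E (fun x => x i - x₀ i) / E (fun _ => 1) ^ 2) := by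
  intro E
  have hs : 0 < (σ ^ 2)⁻¹ := by positivity
  have hsm := smoothed_eq hσ.ne' f x₀
  set s := (σ ^ 2)⁻¹
  let M : (Fin d → ℝ) → ℝ := fun z => tiltIntegral f x₀ s (fun _ => 1) (s • (z - x₀))
  have hM_pos (z : Fin d → ℝ) : 0 < M z := tiltIntegral_one_pos hf hfi hs _
  have hM (z : Fin d → ℝ) : HasFDerivAt M (∑ i, (s * tiltIntegral f x₀ s (fun x => x i - x₀ i)
      (s • (z - x₀))) • (coordProj i : (Fin d → ℝ) →L[ℝ] ℝ)) z := by
    simpa only [one_mul] using hasFDerivAt_tiltIntegral_comp hf hfi hs (k := fun _ => 1)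
      continuous_const (fun x => by simpa using sqDist_nonneg x x₀)
      (fun x i => by simpa using abs_coord_le x x₀ i) z
  have hMj := hasFDerivAt_tiltIntegral_comp hf hfi hs (k := fun x => x j - x₀ j) (by fun_prop)
      (fun x => abs_coord_le x x₀ j)
      (fun x i => (abs_coord_mul_coord_le x x₀ j i).trans (by linarith)) y
  have hlog : (fun z => Real.log (∫ x, exp (-f x) * gKer d σ x z)) = fun z =>
      Real.log ((2 * π * σ ^ 2) ^ (-(d : ℝ) / 2)) - s / 2 * sqDist z x₀ + Real.log (M z) := by
    ext z
    have hc : 0 < (2 * π * σ ^ 2) ^ (-(d : ℝ) / 2) := by positivity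
    rw [hsm z, Real.log_mul (by positivity) (hM_pos z).ne', Real.log_mul hc.ne' (exp_pos _).ne',
      Real.log_exp]
    rfl
  have hgrad (z : Fin d → ℝ) :
      grad' (fun z => Real.log (∫ x, exp (-f x) * gKer d σ x z)) z j
        = -s * (z j - x₀ j) + s * tiltIntegral f x₀ s (fun x => x j - x₀ j) (s • (z - x₀)) * (M z)⁻¹
      := by
    have hq : DifferentiableAt ℝ (fun x => sqDist x x₀) z :=
      (contDiff_sqDist (n := 1) x₀).differentiable one_ne_zero z
    have := (((hq.hasFDerivAt.const_mul (s / 2)).const_sub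
      (Real.log ((2 * π * σ ^ 2) ^ (-(d : ℝ) / 2)))).add ((hM z).log (hM_pos z).ne')).fderiv
    have hq' := grad'_sqDist x₀ z j
    simp only [grad'] at hq' ⊢
    rw [hlog]
    refine (congrArg (fun l : (Fin d → ℝ) →L[ℝ] ℝ => l (Pi.single j 1)) this).trans ?_
    simp [hq', Pi.single_apply]
    ring
  have hhess : HasFDerivAt (fun z => -s * (z j - x₀ j)
      + s * tiltIntegral f x₀ s (fun x => x j - x₀ j) (s • (z - x₀)) * (M z)⁻¹) _ y :=
    (((hasFDerivAt_coord j y).sub_const (x₀ j)).const_mul (-s)).add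
      ((hMj.const_mul s).mul ((hasDerivAt_inv (hM_pos y).ne').comp_hasFDerivAt y (hM y)))
  rw [hess'_eq_fderiv_grad']
  simp only [hgrad]
  rw [hhess.fderiv]
  have hMy : M y ≠ 0 := (hM_pos y).ne'
  change _ = -s * (1 : Matrix (Fin d) (Fin d) ℝ) i j
    + s ^ 2 * (tiltIntegral f x₀ s (fun x => (x j - x₀ j) * (x i - x₀ i)) (s • (y - x₀)) / M y
      - tiltIntegral f x₀ s (fun x => x j - x₀ j) (s • (y - x₀))
        * tiltIntegral f x₀ s (fun x => x i - x₀ i) (s • (y - x₀)) / M y ^ 2)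
  simp only [add_apply, smul_apply, sum_apply, coordProj_apply, smul_eq_mul, Pi.single_apply,
    Matrix.one_apply, mul_ite, mul_one, mul_zero, Finset.sum_ite_eq', Finset.mem_univ, if_true,
    eq_comm (a := j)]
  generalize tiltIntegral f x₀ s (fun x => (x j - x₀ j) * (x i - x₀ i)) (s • (y - x₀)) = c
  generalize tiltIntegral f x₀ s (fun x => x j - x₀ j) (s • (y - x₀)) = e
  generalize tiltIntegral f x₀ s (fun x => x i - x₀ i) (s • (y - x₀)) = e'
  field_simp
  ring

lemma hess'_log_smoothed_comm {σ : ℝ} (hσ : 0 < σ) (hf : Continuous f)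
    (hfi : Integrable fun x => exp (-f x)) (y : Fin d → ℝ) (i j : Fin d) :
    hess' (fun z => Real.log (∫ x, exp (-f x) * gKer d σ x z)) y i j
      = hess' (fun z => Real.log (∫ x, exp (-f x) * gKer d σ x z)) y j i := by
  have hformula := hess'_log_smoothed hσ hf hfi 0 y
  simp only at hformula
  have hcross : (fun x : Fin d → ℝ => (x j - (0 : Fin d → ℝ) j) * (x i - (0 : Fin d → ℝ) i))
      = fun x => (x i - (0 : Fin d → ℝ) i) * (x j - (0 : Fin d → ℝ) j) := by
    ext x
    ring
  rw [hformula i j, hformula j i, hcross]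
  simp only [Matrix.one_apply, eq_comm (a := j)]
  ring

lemma hess'_log_smoothed_quadForm_le {L Δ μ σ : ℝ} (hf : ContDiff ℝ 2 f)
    (hfi : Integrable fun x => exp (-f x)) (hμ : 0 < μ) (hσ : 0 < σ)
    (hhess : ∀ x i, hess' f x i i ≤ L)
    (hgrow : ∀ x, √(∑ i, grad' f x i ^ 2) ≥ μ * √(sqDist x x₀) - Δ) (y v : Fin d → ℝ) :
    ∑ i, ∑ j, v i * hess' (fun z => Real.log (∫ x, exp (-f x) * gKer d σ x z)) y i j * v j
      ≤ (-1 + 3 * L * d / (μ ^ 2 * σ ^ 2) + 3 * Δ ^ 2 / (μ ^ 2 * σ ^ 2)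
        + 3 * sqDist x₀ y / (μ ^ 2 * σ ^ 6)) / σ ^ 2 * ∑ i, v i ^ 2 := by
  have hs : 0 < (σ ^ 2)⁻¹ := by positivity
  have hformula := hess'_log_smoothed hσ hf.continuous hfi x₀ y
  have hmean := mean_sqDist_le hf hfi hμ hs hhess hgrow ((σ ^ 2)⁻¹ • (y - x₀))
  have hZ := tiltIntegral_one_pos (x₀ := x₀) hf.continuous hfi hs ((σ ^ 2)⁻¹ • (y - x₀))
  have hint {k : (Fin d → ℝ) → ℝ} := integrable_mul_exp_neg_tiltPotential (x₀ := x₀) hf.continuous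
    hfi hs ((σ ^ 2)⁻¹ • (y - x₀)) (k := k)
  have hb : ∑ i, ((σ ^ 2)⁻¹ • (y - x₀)) i ^ 2 = ((σ ^ 2)⁻¹) ^ 2 * sqDist x₀ y := by
    rw [sqDist_comm]
    simp only [Pi.smul_apply, Pi.sub_apply, smul_eq_mul, mul_pow, sqDist, Finset.mul_sum]
  rw [hb] at hmean
  let E := fun k => tiltIntegral f x₀ (σ ^ 2)⁻¹ k ((σ ^ 2)⁻¹ • (y - x₀))
  let C := ∑ i, ∑ j, v i * v j * E fun x => (x j - x₀ j) * (x i - x₀ i)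
  let m := ∑ i, v i * E fun x => x i - x₀ i
  have hsum : ∑ i, ∑ j, v i *
        hess' (fun z => Real.log (∫ x, exp (-f x) * gKer d σ x z)) y i j * v j
      = -(σ ^ 2)⁻¹ * ∑ i, v i ^ 2
        + ((σ ^ 2)⁻¹) ^ 2 * (C / E (fun _ => 1) - m ^ 2 / E (fun _ => 1) ^ 2) := by
    have hm2 : m ^ 2 = ∑ i, ∑ j, v i * v j * ((E fun x => x j - x₀ j) * E fun x => x i - x₀ i) := by
      rw [sq, Finset.sum_mul_sum]
      exact Finset.sum_congr rfl fun i _ => Finset.sum_congr rfl fun j _ => by ring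
    have hv2 : ∑ i, v i ^ 2 = ∑ i, ∑ j, v i * v j * (1 : Matrix (Fin d) (Fin d) ℝ) i j := by
      simp [Matrix.one_apply, sq]
    rw [hm2, hv2]
    simp only [C, Finset.sum_div, ← Finset.sum_sub_distrib, Finset.mul_sum,
      ← Finset.sum_add_distrib, hformula]
    exact Finset.sum_congr rfl fun i _ => Finset.sum_congr rfl fun j _ => by ring
  have hC : C ≤ (∑ i, v i ^ 2) * E fun x => sqDist x x₀ := by
    have hij (i j : Fin d) := hint (k := fun x => (x j - x₀ j) * (x i - x₀ i)) (by fun_prop)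
      fun x => (abs_coord_mul_coord_le x x₀ j i).trans (by linarith)
    have hq := hint (k := fun x => sqDist x x₀) (continuous_sqDist x₀) fun x => by
      rw [abs_of_nonneg (sqDist_nonneg x x₀)]
      linarith
    simp only [C, E, tiltIntegral, ← integral_const_mul]
    simp only [← integral_finsetSum _ fun j _ => (hij _ j).const_mul _]
    rw [← integral_finsetSum _ fun i _ =>
      integrable_finsetSum _ fun j _ => (hij i j).const_mul _]
    refine integral_mono
      (integrable_finsetSum _ fun i _ => integrable_finsetSum _ fun j _ => (hij i j).const_mul _)
      (hq.const_mul _) fun x => ?_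
    have hcs := Finset.sum_mul_sq_le_sq_mul_sq Finset.univ v fun i => x i - x₀ i
    have := mul_le_mul_of_nonneg_right hcs
      (exp_pos (-tiltPotential f x₀ (σ ^ 2)⁻¹ ((σ ^ 2)⁻¹ • (y - x₀)) x)).le
    dsimp only
    refine le_trans (le_of_eq ?_) (this.trans_eq (mul_assoc _ _ _))
    rw [sq (∑ i, v i * (x i - x₀ i)), Finset.sum_mul_sum, Finset.sum_mul]
    refine Finset.sum_congr rfl fun i _ => ?_
    rw [Finset.sum_mul]
    exact Finset.sum_congr rfl fun j _ => by ring
  have hv : 0 ≤ ∑ i, v i ^ 2 := Finset.sum_nonneg fun _ _ => sq_nonneg _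
  have hCE : C / E (fun _ => 1)
      ≤ (∑ i, v i ^ 2) * (3 * (L * d + Δ ^ 2 + ((σ ^ 2)⁻¹) ^ 2 * sqDist x₀ y) / μ ^ 2) := by
    rw [div_le_iff₀ hZ, mul_assoc]
    exact hC.trans (mul_le_mul_of_nonneg_left hmean hv)
  calc _ = _ := hsum
    _ ≤ -(σ ^ 2)⁻¹ * ∑ i, v i ^ 2 + ((σ ^ 2)⁻¹) ^ 2 * ((∑ i, v i ^ 2)
        * (3 * (L * d + Δ ^ 2 + ((σ ^ 2)⁻¹) ^ 2 * sqDist x₀ y) / μ ^ 2)) := by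
        gcongr
        exact (sub_le_self _ (by positivity)).trans hCE
    _ = _ := by
        field_simp
        ring

end SmoothedDensity

lemma hess'_apply_self_le {d : ℕ} {f : (Fin d → ℝ) → ℝ} {L : ℝ} {x : Fin d → ℝ}
    (h : ∀ v : Fin d → ℝ, ∑ i, ∑ j, hess' f x i j * v i * v j ≤ L * ∑ i, v i ^ 2) (i : Fin d) :
    hess' f x i i ≤ L := by
  simpa [Pi.single_apply] using h (Pi.single i 1)

/-- If `∇²f ≼ L·I` and `‖∇f(x)‖ ≥ μ‖x − x₀‖ − Δ`, then the Gaussian-smoothed density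
`p_Y` of `Y = X + N(0, σ²I)`, `X ~ e^{−f}/Z`, satisfies
`∇² log p_Y(y) ≼ (−1 + 3Ld/(μ²σ²) + 3Δ²/(μ²σ²) + 3‖x₀−y‖²/(μ²σ⁶))·(I/σ²)`;
in particular `p_Y` is strongly log-concave at `y` when
`3Ld/μ² + 3Δ²/μ² + 3‖x₀−y‖²/(μ²σ⁴) < σ²`. -/
theorem stmt18 (d : ℕ) (σ L Δ : ℝ) (μ : ℝ) (hσ : 0 < σ) (hμ : 0 < μ) (hΔ : 0 ≤ Δ)
    (x₀ : Fin d → ℝ) (f : (Fin d → ℝ) → ℝ) (hf : ContDiff ℝ 2 f)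
    (hfi : Integrable fun x => Real.exp (-f x))
    (hhessUB : ∀ (x v : Fin d → ℝ),
      ∑ i, ∑ j, hess' f x i j * v i * v j ≤ L * ∑ i, v i ^ 2)
    (hgrow : ∀ x : Fin d → ℝ,
      Real.sqrt (∑ i, grad' f x i ^ 2) ≥ μ * Real.sqrt (sqDist x x₀) - Δ) :
    ∀ y : Fin d → ℝ,
      (((-1 + 3 * L * d / (μ ^ 2 * σ ^ 2) + 3 * Δ ^ 2 / (μ ^ 2 * σ ^ 2)
            + 3 * sqDist x₀ y / (μ ^ 2 * σ ^ 6)) / σ ^ 2)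
            • (1 : Matrix (Fin d) (Fin d) ℝ)
          - hess' (fun z => Real.log (∫ x, Real.exp (-f x) * gKer d σ x z)) y).PosSemidef
      ∧ (3 * L * d / μ ^ 2 + 3 * Δ ^ 2 / μ ^ 2 + 3 * sqDist x₀ y / (μ ^ 2 * σ ^ 4) < σ ^ 2 →
          ∃ c : ℝ, 0 < c ∧
            ((-c) • (1 : Matrix (Fin d) (Fin d) ℝ)
              - hess' (fun z => Real.log (∫ x, Real.exp (-f x) * gKer d σ x z)) y).PosSemidef) := by
  intro y
  set κ := (-1 + 3 * L * d / (μ ^ 2 * σ ^ 2) + 3 * Δ ^ 2 / (μ ^ 2 * σ ^ 2)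
    + 3 * sqDist x₀ y / (μ ^ 2 * σ ^ 6)) / σ ^ 2 with hκ
  have hpsd : (κ • (1 : Matrix (Fin d) (Fin d) ℝ)
      - hess' (fun z => Real.log (∫ x, Real.exp (-f x) * gKer d σ x z)) y).PosSemidef := by
    refine Matrix.PosSemidef.of_dotProduct_mulVec_nonneg ?_ fun v => ?_
    · ext i j
      rw [Matrix.conjTranspose_apply, star_trivial, Matrix.sub_apply, Matrix.sub_apply,
        hess'_log_smoothed_comm hσ hf.continuous hfi y j i]
      simp only [Matrix.smul_apply, Matrix.one_apply, eq_comm (a := j)]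
    · have hquad := hess'_log_smoothed_quadForm_le hf hfi hμ hσ
        (fun x => hess'_apply_self_le (hhessUB x)) hgrow y v
      have hdot : v ⬝ᵥ v = ∑ i, v i ^ 2 := by simp [dotProduct, sq]
      rw [star_trivial, Matrix.sub_mulVec, Matrix.smul_mulVec, Matrix.one_mulVec, dotProduct_sub,
        dotProduct_smul, hdot, smul_eq_mul, sub_nonneg]
      refine le_of_eq_of_le ?_ hquad
      simp only [dotProduct, Matrix.mulVec, Finset.mul_sum, mul_assoc]
  refine ⟨hpsd, fun hlt => ⟨-κ, ?_, by rwa [neg_neg]⟩⟩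
  have hκ' : -κ = (σ ^ 2 - (3 * L * d / μ ^ 2 + 3 * Δ ^ 2 / μ ^ 2
      + 3 * sqDist x₀ y / (μ ^ 2 * σ ^ 4))) / σ ^ 4 := by
    rw [hκ]
    field_simp
    ring
  rw [hκ']
  exact div_pos (sub_pos.2 hlt) (by positivity)

end
end
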